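/- Let A ∈ ℝ_max^{n×n} with λ(A) = 0, g = g(C(A)) ≥ 2, T_1(A) = DM(g,n), and not n = g = 2; assume C(A) is strongly connected with a unique critical cycle Z_0 of length g up to choice of its first node. Then for any interesting walk W_0 there is a renumbering of the nodes such that 1,…,g are the nodes of Z_0 and W_0 = (g+1)(g+2)⋯n (1 2 ⋯ n)^g, i.e. W_0 follows the path g+1,…,n and then traverses the Hamiltonian cycle 1,…,n,1 exactly g times. -/

import Mathlib

open scoped Classical

noncomputable section

/-- The max-plus semiring carrier: `ℝ ∪ {-∞}`. `max` is the semiring addition `⊕`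
and `+` (with `⊥` absorbing) is the semiring multiplication `⊗`. -/
abbrev Rmax : Type := WithBot ℝ

/-- Square max-plus matrices. -/
abbrev Mat (n : ℕ) : Type := Fin n → Fin n → Rmax

namespace MaxPlus

variable {n : ℕ}

/-- Entrywise max-plus sum of matrices. -/
def oplus (A B : Mat n) : Mat n := fun i j => max (A i j) (B i j)

/-- Max-plus matrix product. -/
def mul (A B : Mat n) : Mat n := fun i j => Finset.univ.sup fun k => A i k + B k j

/-- Max-plus identity matrix. -/
def idm : Mat n := fun i j => if i = j then 0 else ⊥

/-- Max-plus matrix power. -/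
def pow (A : Mat n) : ℕ → Mat n
  | 0 => idm
  | t + 1 => mul A (pow A t)

/-- The arc relation of the digraph `D(A)`. -/
def arc (A : Mat n) (i j : Fin n) : Prop := A i j ≠ ⊥

/-- `W` is a walk of the digraph with arc relation `R` (a nonempty list of nodes,
consecutive nodes joined by arcs). -/
def IsWalk (R : Fin n → Fin n → Prop) (W : List (Fin n)) : Prop := W ≠ [] ∧ W.Chain' R

/-- `W` is a walk from `i` to `j`. -/
def IsWalkFrom (R : Fin n → Fin n → Prop) (W : List (Fin n)) (i j : Fin n) : Prop :=
  IsWalk R W ∧ W.head? = some i ∧ W.getLast? = some j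

/-- The length of a walk: its number of arcs (= number of nodes minus one). -/
def len (W : List (Fin n)) : ℕ := W.length - 1

/-- The weight `p(W)` of a walk: the max-plus product (= sum) of its arc weights. -/
def weight (A : Mat n) (W : List (Fin n)) : Rmax :=
  ((W.zip W.tail).map fun p => A p.1 p.2).sum

/-- A cycle: a closed walk of positive length with no proper closed subwalk. -/
def IsCycle (R : Fin n → Fin n → Prop) (W : List (Fin n)) : Prop :=
  2 ≤ W.length ∧ W.Chain' R ∧ W.head? = W.getLast? ∧ W.dropLast.Nodup

/-- The mean weight of a cycle: its weight divided by its length. -/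
def mean (A : Mat n) (W : List (Fin n)) : Rmax :=
  (weight A W).map fun r => r / (len W : ℝ)

/-- The maximum cycle mean `λ(A)` (equal to `⊥ = -∞` if there are no cycles). -/
def lam (A : Mat n) : Rmax := sSup {m | ∃ W, IsCycle (arc A) W ∧ m = mean A W}

/-- A critical cycle: a cycle of `D(A)` attaining the maximum cycle mean. -/
def IsCritCycle (A : Mat n) (W : List (Fin n)) : Prop :=
  IsCycle (arc A) W ∧ mean A W = lam A

/-- A node of the critical graph `C(A)`. -/
def critNode (A : Mat n) (i : Fin n) : Prop := ∃ W, IsCritCycle A W ∧ i ∈ W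

/-- An arc of the critical graph `C(A)`. -/
def critArc (A : Mat n) (i j : Fin n) : Prop :=
  ∃ W, IsCritCycle A W ∧ (i, j) ∈ W.zip W.tail

/-- Reachability in the digraph with arc relation `R`. -/
def reach (R : Fin n → Fin n → Prop) (i j : Fin n) : Prop := ∃ W, IsWalkFrom R W i j

/-- `i` and `j` lie in the same strongly connected component. -/
def sameSCC (R : Fin n → Fin n → Prop) (i j : Fin n) : Prop := reach R i j ∧ reach R j i

/-- `i` lies on some cycle of the digraph. -/
def onCycle (R : Fin n → Fin n → Prop) (i : Fin n) : Prop := ∃ W, IsCycle R W ∧ i ∈ W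

/-- The girth of the strongly connected component of `i`: the minimal length of a
cycle meeting that component. -/
def girthAt (R : Fin n → Fin n → Prop) (i : Fin n) : ℕ :=
  sInf {t | ∃ W, IsCycle R W ∧ (∃ v ∈ W, sameSCC R i v) ∧ len W = t}

/-- The maximal girth of a (completely reducible) digraph: the maximum of the girths
of its strongly connected components. -/
def maxGirth (R : Fin n → Fin n → Prop) : ℕ :=
  sSup {g | ∃ i, onCycle R i ∧ girthAt R i = g}

/-- The gcd of the cycle lengths in the strongly connected component of `i`
(described as the greatest common divisor of all such cycle lengths). -/
def sccGcd (R : Fin n → Fin n → Prop) (i : Fin n) : ℕ :=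
  sSup {d | ∀ W, IsCycle R W → (∃ v ∈ W, sameSCC R i v) → d ∣ len W}

/-- The cyclicity of a (completely reducible) digraph: the lcm over its strongly
connected components of the gcds of their cycle lengths. -/
def cyclicity (R : Fin n → Fin n → Prop) : ℕ :=
  (Finset.univ.filter fun i => onCycle R i).lcm (sccGcd R)

/-- Kleene star `X^* = I ⊕ X ⊕ ⋯ ⊕ X^{n-1}`. -/
def star (A : Mat n) : Mat n := fun i j => (Finset.range n).sup fun k => pow A k i j

/-- Scalar (max-plus) multiplication of a matrix. -/
def smul (c : Rmax) (A : Mat n) : Mat n := fun i j => c + A i j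

/-- Max-plus negation (inversion) of a scalar. -/
def negB : Rmax → Rmax := WithBot.map Neg.neg

/-- The CSR term `CS^tR[A]`. -/
def csr (A : Mat n) (t : ℕ) : Mat n :=
  if lam A = ⊥ then fun _ _ => ⊥ else
    let M := star (pow (smul (negB (lam A)) A) (cyclicity (critArc A)))
    let C : Mat n := fun i j => if critNode A j then M i j else ⊥
    let S : Mat n := fun i j => if critArc A i j then A i j else ⊥
    let R : Mat n := fun i j => if critNode A i then M i j else ⊥
    mul C (mul (pow S t) R)

/-- The Nachtigall matrix `B_N`: entries with a critical index are set to `-∞`. -/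
def bN (A : Mat n) : Mat n := fun i j => if critNode A i ∨ critNode A j then ⊥ else A i j

/-- The weak CSR threshold `T₁(A) = T₁(A, B_N)`. -/
def T1 (A : Mat n) : ℕ :=
  sInf {T | ∀ t, T ≤ t → pow A t = oplus (csr A t) (pow (bN A) t)}

/-- The Dulmage–Mendelsohn bound `DM(g,n) = g(n-2) + n`. -/
def DM (g N : ℕ) : ℕ := g * (N - 2) + N

/-- The Wielandt bound `Wi(n)`. -/
def Wi (N : ℕ) : ℕ := if N = 1 then 0 else (N - 1) ^ 2 + 1

/-- The matrix `A₁` (0-indexed version of Equation (5) of the paper): it keeps the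
arcs `(i,i+1)` for `1 ≤ i ≤ n-1`, `(n,1)` and `(g,1)` of `A` (in 1-indexed terms). -/
def A1 (A : Mat n) (g : ℕ) : Mat n := fun i j =>
  if j.val = i.val + 1 ∨ (i.val = n - 1 ∧ j.val = 0) ∨ (i.val = g - 1 ∧ j.val = 0)
  then A i j else ⊥

/-- The matrix `B₁`: it keeps the arcs `(i,j)` with `i > g`, `j > g`,
`j ≡ i+1 (mod g)` (in 1-indexed terms). -/
def B1 (A : Mat n) (g : ℕ) : Mat n := fun i j =>
  if g ≤ i.val ∧ g ≤ j.val ∧ j.val % g = (i.val + 1) % g then A i j else ⊥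

/-- The matrix `A₂`: the remaining entries of `A`. -/
def A2 (A : Mat n) (g : ℕ) : Mat n := fun i j =>
  if oplus (A1 A g) (B1 A g) i j ≠ ⊥ then ⊥ else A i j

/-- Strict domination of matrices: `X < Y` entrywise, equality allowed only at `-∞`. -/
def mLt (X Y : Mat n) : Prop := ∀ i j, X i j < Y i j ∨ (X i j = ⊥ ∧ Y i j = ⊥)

/-- The cycle `1 2 ⋯ g 1` (0-indexed: the node list `[0,1,…,g-1,0]`). -/
def stdCyc (N g : ℕ) : List (Fin N) := (List.finRange N).take g ++ (List.finRange N).take 1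

/-- The node list of the walk `(g+1)⋯n(1⋯n)^g` (0-indexed). -/
def wInteresting (N g : ℕ) : List (Fin N) :=
  (List.finRange N).drop g ++ (List.replicate g (List.finRange N)).flatten

/-- The node list of the walk `n(1⋯(n-1))^{n-1}1⋯n` (0-indexed). -/
def wWielandt (N : ℕ) : List (Fin N) :=
  (List.finRange N).drop (N - 1) ++
    (List.replicate (N - 1) ((List.finRange N).take (N - 1))).flatten ++ List.finRange N

/-- Walks from `i` to `j` through a node of `Z₀` whose length is `≡ m (mod γ)`. -/
def ThroughSet (A : Mat n) (Z0 : List (Fin n)) (i j : Fin n) (γ m : ℕ) :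
    Set (List (Fin n)) :=
  {V | IsWalkFrom (arc A) V i j ∧ (∃ v ∈ V, v ∈ Z0) ∧ len V % γ = m % γ}

/-- A twice optimal walk: of minimal length among the walks of maximal weight in
`ThroughSet A Z0 i j γ m`. -/
def TwiceOpt (A : Mat n) (Z0 : List (Fin n)) (i j : Fin n) (γ m : ℕ)
    (W : List (Fin n)) : Prop :=
  W ∈ ThroughSet A Z0 i j γ m ∧
  (∀ V ∈ ThroughSet A Z0 i j γ m, weight A V ≤ weight A W) ∧
  (∀ V ∈ ThroughSet A Z0 i j γ m, weight A V = weight A W → len W ≤ len V)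

/-- An interesting walk: twice optimal (for residue `DM(g,n) - 1` modulo `g`) of
length `DM(g,n) + g - 1`. -/
def Interesting (A : Mat n) (g : ℕ) (Z0 : List (Fin n)) (i j : Fin n)
    (W : List (Fin n)) : Prop :=
  TwiceOpt A Z0 i j g (DM g n - 1) W ∧ len W = DM g n + g - 1

/-- The index of a digraph: the transient of its Boolean adjacency matrix. -/
def Tind (R : Fin n → Fin n → Prop) : ℕ :=
  sInf {T | ∀ t, T ≤ t → ∀ i j : Fin n,
    (∃ W, IsWalkFrom R W i j ∧ len W = t) ↔
      (∃ W, IsWalkFrom R W i j ∧ len W = t + cyclicity R)}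

/-- The transient of row `i` of `A`. -/
def rowTrans (A : Mat n) (i : Fin n) : ℕ :=
  sInf {T | ∀ t, T ≤ t → ∀ j, pow A t i j = csr A t i j}

/-- The transient of column `i` of `A`. -/
def colTrans (A : Mat n) (i : Fin n) : ℕ :=
  sInf {T | ∀ t, T ≤ t → ∀ j, pow A t j i = csr A t j i}

/-- The maximum of the transients of the critical rows and columns of `A`. -/
def critTransMax (A : Mat n) : ℕ :=
  (Finset.univ.filter fun i => critNode A i).sup fun i =>
    max (rowTrans A i) (colTrans A i)

/-- Renumbering of the nodes of `A` by a permutation `σ`. -/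
def renum (σ : Equiv.Perm (Fin n)) (A : Mat n) : Mat n := fun i j => A (σ i) (σ j)

end MaxPlus

namespace MaxPlus

/-- Walks from `a` to `b`, recorded by their length and their real weight. -/
inductive WalkW {V : Type*} (E : V → V → Prop) (w : V → V → ℝ) : ℕ → ℝ → V → V → Prop
  | nil (a : V) : WalkW E w 0 0 a a
  | cons {a b c : V} {l : ℕ} {r : ℝ} :
      E a b → WalkW E w l r b c → WalkW E w (l + 1) (w a b + r) a c

/-- The weight of the first `k` arcs of the sequence `x`. -/
def partialW {V : Type*} (w : V → V → ℝ) (x : ℕ → V) (k : ℕ) : ℝ :=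
  ∑ i ∈ Finset.range k, w (x i) (x (i + 1))

section Walks

variable {V : Type*} {E : V → V → Prop} {w : V → V → ℝ}

theorem partialW_succ (x : ℕ → V) (k : ℕ) :
    partialW w x (k + 1) = partialW w x k + w (x k) (x (k + 1)) :=
  Finset.sum_range_succ _ _

theorem WalkW.trans {l₁ l₂ : ℕ} {r₁ r₂ : ℝ} {a b c : V} (h₁ : WalkW E w l₁ r₁ a b)
    (h₂ : WalkW E w l₂ r₂ b c) : WalkW E w (l₁ + l₂) (r₁ + r₂) a c := by
  induction h₁ with
  | nil a => simpa using h₂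
  | cons h _ ih =>
    have := WalkW.cons h (ih h₂)
    rwa [← add_assoc, add_right_comm] at this

theorem WalkW.single {a b : V} (h : E a b) : WalkW E w 1 (w a b) a b := by
  simpa using WalkW.cons (w := w) h (WalkW.nil b)

theorem WalkW.of_seq {x : ℕ → V} {i j : ℕ} (hij : i ≤ j)
    (h : ∀ k, i ≤ k → k < j → E (x k) (x (k + 1))) :
    WalkW E w (j - i) (partialW w x j - partialW w x i) (x i) (x j) := by
  induction j, hij using Nat.le_induction with
  | base => simpa using WalkW.nil (E := E) (w := w) (x i)
  | succ j hij ih =>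
    have h1 := (ih fun k hk hkj => h k hk (by omega)).trans
      (WalkW.single (w := w) (h j hij (by omega)))
    rw [partialW_succ, show j + 1 - i = j - i + 1 by omega]
    convert h1 using 1
    ring

end Walks

/-- A walk `x 0, …, x (N - 1)` on `n` nodes that is twice optimal among the walks meeting the
weight-zero cycle `y` of length `g`, and that has the largest possible length. -/
structure TightWalk {n g : ℕ} (E : Fin n → Fin n → Prop) (w : Fin n → Fin n → ℝ)
    (y : ZMod g → Fin n) (x : ℕ → Fin n) (N : ℕ) : Prop where
  two_le : 2 ≤ g
  card : N + g = g * n + n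
  inj : Function.Injective y
  closed : ∀ l r a, WalkW E w l r a a → r ≤ 0
  arc_y : ∀ i, E (y i) (y (i + 1))
  w_y : ∀ i, w (y i) (y (i + 1)) = 0
  arc_x : ∀ i, i + 1 < N → E (x i) (x (i + 1))
  meets : ∃ k < N, x k ∈ Set.range y
  opt : ∀ l₁ l₂ r₁ r₂ c, WalkW E w l₁ r₁ (x 0) (y c) → WalkW E w l₂ r₂ (y c) (x (N - 1)) →
    ((l₁ + l₂ : ℕ) : ZMod g) = ((N - 1 : ℕ) : ZMod g) → partialW w x (N - 1) ≤ r₁ + r₂ →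
    N - 1 ≤ l₁ + l₂

namespace TightWalk

variable {n g : ℕ} {E : Fin n → Fin n → Prop} {w : Fin n → Fin n → ℝ}
  {y : ZMod g → Fin n} {x : ℕ → Fin n} {N : ℕ}

theorem le_n (H : TightWalk E w y x N) : g ≤ n := by
  have : NeZero g := ⟨by have := H.two_le; omega⟩
  simpa [ZMod.card] using Fintype.card_le_of_injective y H.inj

theorem sub (H : TightWalk E w y x N) {i j : ℕ} (hij : i ≤ j) (hj : j < N) :
    WalkW E w (j - i) (partialW w x j - partialW w x i) (x i) (x j) :=
  WalkW.of_seq hij fun k _ hk => H.arc_x k (by omega)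

theorem splice (H : TightWalk E w y x N) {p q r s l₁ l₂ : ℕ} {r₁ r₂ : ℝ}
    (hpq : p ≤ q) (hqr : q ≤ r) (hrs : r ≤ s) (hs : s < N)
    (h₁ : WalkW E w l₁ r₁ (x p) (x q)) (h₂ : WalkW E w l₂ r₂ (x r) (x s))
    (hw : partialW w x q - partialW w x p + (partialW w x s - partialW w x r) ≤ r₁ + r₂)
    (hl : (l₁ + l₂ : ZMod g) = (q - p) + (s - r))
    (hZ : ∃ k < N, x k ∈ Set.range y ∧ (k ≤ p ∨ (q ≤ k ∧ k ≤ r) ∨ s ≤ k)) :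
    (q - p) + (s - r) ≤ l₁ + l₂ := by
  obtain ⟨k, hkN, ⟨c, hc⟩, hk⟩ := hZ
  have hcong : ∀ a b : ℕ, a + b = p + (r - q) + (N - 1 - s) + l₁ + l₂ →
      ((a + b : ℕ) : ZMod g) = ((N - 1 : ℕ) : ZMod g) := by
    intro a b hab
    rw [hab]
    have h1 : ((N - 1 : ℕ) : ZMod g) = (((r - q) + (N - 1 - s) + (q - p) + (s - r) + p : ℕ)) := by
      congr 1; omega
    rw [h1]
    push_cast [Nat.cast_sub hpq, Nat.cast_sub hrs]
    linear_combination hl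
  have h0 : partialW w x 0 = 0 := by simp [partialW]
  rcases hk with hk | ⟨hk, hk'⟩ | hk
  · have a1 := H.sub (Nat.zero_le k) hkN
    have a2 := (((H.sub hk (by omega)).trans h₁).trans (H.sub hqr (by omega))).trans
      (h₂.trans (H.sub (show s ≤ N - 1 by omega) (by omega)))
    rw [← hc] at a1 a2
    have := H.opt _ _ _ _ _ a1 a2 (hcong _ _ (by omega)) (by linarith)
    omega
  · have a1 := ((H.sub (Nat.zero_le p) (by omega)).trans h₁).trans (H.sub hk (by omega))
    have a2 := (H.sub hk' (by omega)).trans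
      (h₂.trans (H.sub (show s ≤ N - 1 by omega) (by omega)))
    rw [← hc] at a1 a2
    have := H.opt _ _ _ _ _ a1 a2 (hcong _ _ (by omega)) (by linarith)
    omega
  · have a1 := ((((H.sub (Nat.zero_le p) (by omega)).trans h₁).trans
      (H.sub hqr (by omega))).trans h₂).trans (H.sub hk (by omega))
    have a2 := (H.sub (show k ≤ N - 1 by omega) (by omega))
    rw [← hc] at a1 a2
    have := H.opt _ _ _ _ _ a1 a2 (hcong _ _ (by omega)) (by linarith)
    omega

theorem closed_x (H : TightWalk E w y x N) {i j : ℕ} (hij : i ≤ j) (hj : j < N)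
    (h : x i = x j) : partialW w x j - partialW w x i ≤ 0 := by
  have := H.sub hij hj
  rw [h] at this
  exact H.closed _ _ _ this

theorem walk_y (H : TightWalk E w y x N) (c : ZMod g) (l : ℕ) :
    WalkW E w l 0 (y c) (y (c + l)) := by
  induction l with
  | zero => simpa using WalkW.nil (E := E) (w := w) (y c)
  | succ l ih =>
    have := ih.trans (WalkW.single (w := w) (H.arc_y (c + l)))
    rw [H.w_y] at this
    simpa [add_assoc] using this

theorem walk_y_to (H : TightWalk E w y x N) (c d : ZMod g) :
    ∃ l < g, (l : ZMod g) = d - c ∧ WalkW E w l 0 (y c) (y d) := by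
  have : NeZero g := ⟨by have := H.two_le; omega⟩
  refine ⟨(d - c).val, ZMod.val_lt _, by simp, ?_⟩
  simpa using H.walk_y c (d - c).val

theorem nonpos_y (H : TightWalk E w y x N) {l : ℕ} {r : ℝ} {c d : ZMod g}
    (h : WalkW E w l r (y c) (y d)) : r ≤ 0 := by
  obtain ⟨l', -, -, h'⟩ := H.walk_y_to d c
  simpa using H.closed _ _ _ (h.trans h')

theorem nonpos_x (H : TightWalk E w y x N) {i j : ℕ} (hij : i ≤ j) (hj : j < N) {c d : ZMod g}
    (hi : x i = y c) (hjd : x j = y d) : partialW w x j - partialW w x i ≤ 0 := by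
  have := H.sub hij hj
  rw [hi, hjd] at this
  exact H.nonpos_y this

/-- Two segments between nodes of the cycle are replaced by arcs of the cycle. -/
theorem jump_jump (H : TightWalk E w y x N) {p q r s : ℕ} {cp cq cr cs : ZMod g}
    (hpq : p ≤ q) (hqr : q ≤ r) (hrs : r ≤ s) (hs : s < N)
    (hp : x p = y cp) (hq : x q = y cq) (hr : x r = y cr) (hxs : x s = y cs)
    (h : ((q : ZMod g) - cq) - (p - cp) + ((s - cs) - (r - cr)) = 0) :
    (q - p) + (s - r) ≤ (g - 1) + (g - 1) := by
  obtain ⟨l₁, hl₁, e₁, h₁⟩ := H.walk_y_to cp cq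
  obtain ⟨l₂, hl₂, e₂, h₂⟩ := H.walk_y_to cr cs
  have n1 := H.nonpos_x hpq (by omega) hp hq
  have n2 := H.nonpos_x hrs (by omega) hr hxs
  rw [← hp, ← hq] at h₁
  rw [← hr, ← hxs] at h₂
  have := H.splice hpq hqr hrs hs h₁ h₂ (by linarith)
    (by rw [e₁, e₂]; linear_combination -h) ⟨p, by omega, ⟨cp, hp.symm⟩, Or.inl le_rfl⟩
  omega

theorem jump (H : TightWalk E w y x N) {p q : ℕ} {cp cq : ZMod g}
    (hpq : p ≤ q) (hq' : q < N) (hp : x p = y cp) (hq : x q = y cq)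
    (h : (q : ZMod g) - cq = p - cp) : q - p < g := by
  obtain ⟨l₁, hl₁, e₁, h₁⟩ := H.walk_y_to cp cq
  have n1 := H.nonpos_x hpq (by omega) hp hq
  rw [← hp, ← hq] at h₁
  have := H.splice hpq le_rfl le_rfl hq' h₁ (WalkW.nil (x q)) (by linarith)
    (by rw [e₁]; push_cast; linear_combination -h)
    ⟨p, by omega, ⟨cp, hp.symm⟩, Or.inl le_rfl⟩
  omega

/-- A closed segment is removed and a segment between nodes of the cycle is replaced. -/
theorem cut_jump (H : TightWalk E w y x N) {a b s t : ℕ} {cs ct : ZMod g}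
    (hab : a < b) (hst : s ≤ t) (hb : b < N) (ht : t < N) (hd : t ≤ a ∨ b ≤ s)
    (hx : x a = x b) (hs : x s = y cs) (hxt : x t = y ct)
    (h : (b : ZMod g) - a + ((t - ct) - (s - cs)) = 0) : (b - a) + (t - s) ≤ g - 1 := by
  obtain ⟨l, hl, e, h₁⟩ := H.walk_y_to cs ct
  have n1 := H.nonpos_x hst (by omega) hs hxt
  have n2 := H.closed_x hab.le hb hx
  rw [← hs, ← hxt] at h₁
  have h2 : WalkW E w 0 0 (x a) (x b) := hx ▸ WalkW.nil (x a)
  rcases hd with hd | hd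
  · have := H.splice hst hd hab.le hb h₁ h2 (by linarith)
      (by rw [e]; push_cast; linear_combination -h) ⟨s, by omega, ⟨cs, hs.symm⟩, Or.inl le_rfl⟩
    omega
  · have := H.splice hab.le hd hst ht h2 h₁ (by linarith)
      (by rw [e]; push_cast; linear_combination -h)
      ⟨s, by omega, ⟨cs, hs.symm⟩, Or.inr (Or.inl ⟨hd, le_rfl⟩)⟩
    omega

theorem cut_cut (H : TightWalk E w y x N) {p q r s k : ℕ} {c : ZMod g}
    (hpq : p ≤ q) (hrs : r ≤ s) (hs : s < N)
    (hp : x p = x q) (hr : x r = x s) (hk : x k = y c) (hqk : q ≤ k) (hkr : k ≤ r)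
    (h : (q : ZMod g) - p + (s - r) = 0) : p = q ∧ r = s := by
  have n1 := H.closed_x hpq (by omega) hp
  have n2 := H.closed_x hrs hs hr
  have h1 : WalkW E w 0 0 (x p) (x q) := hp ▸ WalkW.nil (x p)
  have h2 : WalkW E w 0 0 (x r) (x s) := hr ▸ WalkW.nil (x r)
  have := H.splice hpq (hqk.trans hkr) hrs hs h1 h2 (by linarith)
    (by push_cast; linear_combination -h)
    ⟨k, by omega, ⟨c, hk.symm⟩, Or.inr (Or.inl ⟨hqk, hkr⟩)⟩
  omega

theorem cut (H : TightWalk E w y x N) {p q k : ℕ} {c : ZMod g}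
    (hpq : p < q) (hq : q < N) (hp : x p = x q) (hkN : k < N) (hk : x k = y c)
    (hd : k ≤ p ∨ q ≤ k) : (q : ZMod g) ≠ p := by
  intro h
  have := H.cut_jump hpq le_rfl hq hkN hd hp hk hk (by rw [h]; ring)
  have n2 := H.closed_x hpq.le hq hp
  have h1 : WalkW E w 0 0 (x p) (x q) := hp ▸ WalkW.nil (x p)
  have := H.splice hpq.le le_rfl le_rfl hq h1 (WalkW.nil (x q)) (by linarith)
    (by push_cast; rw [h]; ring) ⟨k, hkN, ⟨c, hk.symm⟩, by omega⟩
  omega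

end TightWalk
end MaxPlus

namespace MaxPlus
namespace TightWalk

variable {n g : ℕ} {E : Fin n → Fin n → Prop} {w : Fin n → Fin n → ℝ}
  {y : ZMod g → Fin n} {x : ℕ → Fin n} {N : ℕ}

/-- The position `i` modulo `g`, relative to the index of `x i` on the cycle `y`. -/
def phase (y : ZMod g → Fin n) (x : ℕ → Fin n) (i : ℕ) : ZMod g :=
  (i : ZMod g) - Function.invFun y (x i)

theorem phase_eq (H : TightWalk E w y x N) {i : ℕ} {c : ZMod g} (h : x i = y c) :
    phase y x i = i - c := by
  rw [phase, h, Function.leftInverse_invFun H.inj]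

theorem eq_y (H : TightWalk E w y x N) {i : ℕ} (h : x i ∈ Set.range y) :
    x i = y (i - phase y x i) := by
  obtain ⟨c, hc⟩ := h
  rw [H.phase_eq hc.symm, sub_sub_cancel, hc]

theorem card_visits_le (H : TightWalk E w y x N) {u : Fin n} (hu : u ∉ Set.range y) :
    ((Finset.range N).filter fun i => x i = u).card ≤ g + 1 := by
  have : NeZero g := ⟨by have := H.two_le; omega⟩
  by_contra hcard
  obtain ⟨k, hkN, ⟨c, hc⟩⟩ := H.meets
  set P := (Finset.range N).filter fun i => x i = u with hP
  have memP : ∀ i, i ∈ P ↔ i < N ∧ x i = u := by simp [hP]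
  have hPk : ∀ i ∈ P, i ≠ k := by
    rintro i hi rfl
    exact hu ⟨c, hc.trans ((memP i).1 hi).2⟩
  obtain ⟨e, e', he⟩ : ∃ e e', ∀ s ∈ P, ∀ t ∈ P, s < k → k < t →
      s ≤ e' ∧ e' < k ∧ k < e ∧ e ≤ t ∧ x e = u ∧ x e' = u := by
    by_cases hL : (P.filter (· < k)).Nonempty
    · by_cases hR : (P.filter (k < ·)).Nonempty
      · have h1 := Finset.max'_mem _ hL
        have h2 := Finset.min'_mem _ hR
        rw [Finset.mem_filter, memP] at h1 h2
        exact ⟨_, _, fun s hs t ht hsk hkt =>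
          ⟨Finset.le_max' _ _ (Finset.mem_filter.2 ⟨hs, hsk⟩), h1.2, h2.2,
            Finset.min'_le _ _ (Finset.mem_filter.2 ⟨ht, hkt⟩), h2.1.2, h1.1.2⟩⟩
      · exact ⟨0, 0, fun s hs t ht _ hkt => (hR ⟨t, Finset.mem_filter.2 ⟨ht, hkt⟩⟩).elim⟩
    · exact ⟨0, 0, fun s hs t ht hsk _ => (hL ⟨s, Finset.mem_filter.2 ⟨hs, hsk⟩⟩).elim⟩
  let f : ℕ → ZMod g := fun s => if s < k then (s : ZMod g) else s - (e - e')
  have hcQ : (Finset.univ : Finset (ZMod g)).card < (P.erase e).card := by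
    have := Finset.pred_card_le_card_erase (s := P) (a := e)
    rw [Finset.card_univ, ZMod.card]
    omega
  obtain ⟨a, ha, b, hb, hab, hf⟩ :=
    Finset.exists_ne_map_eq_of_card_lt_of_maps_to (f := f) hcQ fun _ _ => Finset.mem_univ _
  wlog hlt : a < b generalizing a b
  · exact this b hb a ha hab.symm hf.symm (by omega)
  obtain ⟨-, haP⟩ := Finset.mem_erase.1 ha
  obtain ⟨hbe, hbP⟩ := Finset.mem_erase.1 hb
  have hak := hPk a haP
  have hbk := hPk b hbP
  have hxa := (memP a).1 haP
  have hxb := (memP b).1 hbP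
  rcases lt_or_gt_of_ne hbk with hb' | hb'
  · refine H.cut hlt hxb.1 (hxa.2.trans hxb.2.symm) hkN hc.symm (by omega) ?_
    simpa [f, hb', hlt.trans hb'] using hf.symm
  · rcases lt_or_gt_of_ne hak with ha' | ha'
    · obtain ⟨h1, h2, h3, h4, h5, h6⟩ := he a haP b hbP ha' hb'
      have := H.cut_cut h1 h4 hxb.1 (hxa.2.trans h6.symm) (h5.trans hxb.2.symm) hc.symm
        h2.le h3.le (by
          simp only [f, ha', if_true, hb'.not_gt, if_false] at hf
          linear_combination -hf)
      exact hbe this.2.symm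
    · refine H.cut hlt hxb.1 (hxa.2.trans hxb.2.symm) hkN hc.symm (by omega) ?_
      simpa [f, hb'.not_gt, ha'.not_gt] using hf.symm

theorem card_phase_le (H : TightWalk E w y x N) {c : ZMod g} {P : Finset ℕ}
    (hP : ∀ i ∈ P, i < N ∧ x i ∈ Set.range y ∧ phase y x i = c) (hne : P.Nonempty) :
    P ⊆ Finset.Ico (P.min' hne) (P.min' hne + g) := by
  intro i hi
  have h1 := Finset.min'_le _ _ hi
  obtain ⟨-, h2, h3⟩ := hP _ (Finset.min'_mem P hne)
  obtain ⟨h4, h5, h6⟩ := hP _ hi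
  have := H.jump h1 h4 (H.eq_y h2) (H.eq_y h5) (by rw [h3, h6]; ring)
  exact Finset.mem_Ico.2 ⟨h1, by omega⟩

theorem counting (H : TightWalk E w y x N) :
    (∀ u ∉ Set.range y, ((Finset.range N).filter fun i => x i = u).card = g + 1) ∧
    ∀ c : ZMod g, ∃ b, ∀ i, (i < N ∧ x i ∈ Set.range y ∧ phase y x i = c) ↔
      b ≤ i ∧ i < b + g := by
  have : NeZero g := ⟨by have := H.two_le; omega⟩
  have hgn := H.le_n
  let U : Finset (Fin n) := Finset.univ.filter (· ∉ Set.range y)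
  have hUcard : U.card = n - g := by
    have h1 : (Finset.univ.filter (· ∈ Set.range y)).card = g := by
      have : Finset.univ.filter (· ∈ Set.range y) = Finset.univ.image y := by ext; simp
      rw [this, Finset.card_image_of_injective _ H.inj, Finset.card_univ, ZMod.card]
    have h2 := Finset.card_filter_add_card_filter_not (s := (Finset.univ : Finset (Fin n)))
      (· ∈ Set.range y)
    rw [h1, Finset.card_univ, Fintype.card_fin] at h2
    show (Finset.univ.filter (¬ · ∈ Set.range y)).card = _
    omega
  let PU := (Finset.range N).filter (x · ∉ Set.range y)
  let PZ := (Finset.range N).filter (x · ∈ Set.range y)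
  have hsum : PZ.card + PU.card = N := by
    have := Finset.card_filter_add_card_filter_not (s := Finset.range N) (x · ∈ Set.range y)
    rwa [Finset.card_range] at this
  have hPU : PU.card = ∑ u ∈ U, (PU.filter (x · = u)).card :=
    Finset.card_eq_sum_card_fiberwise fun i hi => by
      have : x i ∉ Set.range y := (Finset.mem_filter.1 hi).2
      exact Finset.mem_filter.2 ⟨Finset.mem_univ _, this⟩
  have hPZ : PZ.card = ∑ c : ZMod g, (PZ.filter (phase y x · = c)).card :=
    Finset.card_eq_sum_card_fiberwise fun i _ => Finset.mem_univ _
  have hPUf : ∀ u ∈ U, PU.filter (x · = u) = (Finset.range N).filter fun i => x i = u := by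
    intro u hu
    have hu' : u ∉ Set.range y := (Finset.mem_filter.1 hu).2
    ext i
    simp only [PU, Finset.mem_filter]
    constructor
    · rintro ⟨⟨h1, -⟩, h2⟩; exact ⟨h1, h2⟩
    · rintro ⟨h1, h2⟩; exact ⟨⟨h1, h2 ▸ hu'⟩, h2⟩
  have hU : ∀ u ∈ U, (PU.filter (x · = u)).card ≤ g + 1 := by
    intro u hu
    rw [hPUf u hu]
    exact H.card_visits_le (Finset.mem_filter.1 hu).2
  have hZ' : ∀ c, ∀ i ∈ PZ.filter (phase y x · = c),
      i < N ∧ x i ∈ Set.range y ∧ phase y x i = c := by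
    intro c i hi
    simpa [PZ, and_assoc] using hi
  have hZ : ∀ c ∈ (Finset.univ : Finset (ZMod g)), (PZ.filter (phase y x · = c)).card ≤ g := by
    intro c _
    rcases (PZ.filter (phase y x · = c)).eq_empty_or_nonempty with h | h
    · simp [h]
    · simpa using Finset.card_le_card (H.card_phase_le (hZ' c) h)
  have hle1 : PU.card ≤ (n - g) * (g + 1) := by
    rw [hPU, ← hUcard]; simpa using Finset.sum_le_card_nsmul _ _ _ hU
  have hle2 : PZ.card ≤ g * g := by
    rw [hPZ]; simpa [ZMod.card] using Finset.sum_le_card_nsmul _ _ _ hZ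
  have htot : (n - g) * (g + 1) + g * g = N := by
    have := H.card
    obtain ⟨m, rfl⟩ := Nat.exists_eq_add_of_le hgn
    rw [Nat.add_sub_cancel_left]
    nlinarith
  constructor
  · intro u hu
    have hu' : u ∈ U := Finset.mem_filter.2 ⟨Finset.mem_univ _, hu⟩
    have := (Finset.sum_eq_sum_iff_of_le hU).1 (by
      rw [← hPU, Finset.sum_const, hUcard, smul_eq_mul]; omega) u hu'
    rwa [hPUf u hu'] at this
  · intro c
    have := (Finset.sum_eq_sum_iff_of_le hZ).1 (by
      rw [← hPZ, Finset.sum_const, Finset.card_univ, ZMod.card, smul_eq_mul]; omega) c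
      (Finset.mem_univ _)
    have hne : (PZ.filter (phase y x · = c)).Nonempty := by
      rw [← Finset.card_pos, this]; have := H.two_le; omega
    have heq := Finset.eq_of_subset_of_card_le (H.card_phase_le (hZ' c) hne) (by simp [this])
    refine ⟨(PZ.filter (phase y x · = c)).min' hne, fun i => ?_⟩
    rw [← Finset.mem_Ico, ← heq]
    simp [PZ, and_assoc]

end TightWalk
end MaxPlus

namespace MaxPlus

/-- `B 0 < B 1 < ⋯ < B (g - 1)` are the starting positions of the passages of `x` through the
cycle `y`; each passage has `g` nodes and its own phase. -/
structure Blocks {n g : ℕ} (y : ZMod g → Fin n) (x : ℕ → Fin n) (N : ℕ) (B : ℕ → ℕ) : Prop where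
  sep : ∀ h k, h < k → k < g → B h + g ≤ B k
  mem : ∀ h < g, ∀ i, B h ≤ i → i < B h + g →
    i < N ∧ x i ∈ Set.range y ∧ TightWalk.phase y x i = TightWalk.phase y x (B h)
  inj : ∀ h < g, ∀ k < g, TightWalk.phase y x (B h) = TightWalk.phase y x (B k) → h = k
  surj : ∀ c, ∃ h < g, TightWalk.phase y x (B h) = c
  cover : ∀ i < N, x i ∈ Set.range y → ∃ h < g, B h ≤ i ∧ i < B h + g

namespace TightWalk

variable {n g : ℕ} {E : Fin n → Fin n → Prop} {w : Fin n → Fin n → ℝ}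
  {y : ZMod g → Fin n} {x : ℕ → Fin n} {N : ℕ} {B : ℕ → ℕ}

theorem exists_blocks (H : TightWalk E w y x N) : ∃ B, Blocks y x N B := by
  have : NeZero g := ⟨by have := H.two_le; omega⟩
  choose b hb using H.counting.2
  have hg := H.two_le
  have hbc : ∀ c, phase y x (b c) = c := fun c => ((hb c _).2 ⟨le_rfl, by omega⟩).2.2
  have hbinj : Function.Injective b := fun c d h => by rw [← hbc c, h, hbc]
  let S : Finset ℕ := Finset.univ.image b
  have hS : S.card = g := by
    rw [Finset.card_image_of_injective _ hbinj, Finset.card_univ, ZMod.card]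
  let f := S.orderEmbOfFin hS
  let B : ℕ → ℕ := fun h => if hh : h < g then f ⟨h, hh⟩ else 0
  have hBf : ∀ h (hh : h < g), B h = f ⟨h, hh⟩ := fun h hh => dif_pos hh
  have hBb : ∀ h < g, B h = b (phase y x (B h)) := by
    intro h hh
    have : B h ∈ S := by rw [hBf h hh]; exact S.orderEmbOfFin_mem hS _
    obtain ⟨c, -, hc⟩ := Finset.mem_image.1 this
    rw [← hc, hbc]
  have hbB : ∀ c, ∃ h < g, B h = b c := by
    intro c
    have : b c ∈ Set.range f := by
      rw [Finset.range_orderEmbOfFin]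
      exact Finset.mem_coe.2 (Finset.mem_image_of_mem _ (Finset.mem_univ c))
    obtain ⟨h, hh⟩ := this
    exact ⟨h, h.2, by rw [hBf h h.2, hh]⟩
  have hmem : ∀ h < g, ∀ i, (i < N ∧ x i ∈ Set.range y ∧ phase y x i = phase y x (B h)) ↔
      B h ≤ i ∧ i < B h + g := by
    intro h hh i
    rw [hb, ← hBb h hh]
  have hlt : ∀ h k, h < k → k < g → B h < B k := by
    intro h k hk hkg
    rw [hBf h (by omega), hBf k hkg]
    exact f.strictMono (by simpa using hk)
  have hinj : ∀ h < g, ∀ k < g, phase y x (B h) = phase y x (B k) → h = k := by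
    intro h hh k hk e
    have : B h = B k := by rw [hBb h hh, e, ← hBb k hk]
    rcases lt_trichotomy h k with hl | hl | hl
    · have := hlt h k hl hk; omega
    · exact hl
    · have := hlt k h hl hh; omega
  refine ⟨B, ?_, fun h hh i h1 h2 => (hmem h hh i).2 ⟨h1, h2⟩, hinj, ?_, ?_⟩
  · intro h k hk hkg
    by_contra hlt'
    have h1 := (hmem h (by omega) (B k)).2 ⟨(hlt h k hk hkg).le, by omega⟩
    have := hinj _ hkg _ (by omega) h1.2.2
    omega
  · intro c
    obtain ⟨h, hh, e⟩ := hbB c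
    exact ⟨h, hh, by rw [e, hbc]⟩
  · intro i hi hx
    obtain ⟨h, hh, e⟩ := hbB (phase y x i)
    exact ⟨h, hh, by rw [e]; exact (hb _ i).1 ⟨hi, hx, rfl⟩⟩

theorem B_mem (hB : Blocks y x N B) {h : ℕ} (hh : h < g) :
    B h < N ∧ x (B h) ∈ Set.range y := by
  have := hB.mem h hh (B h) le_rfl (by omega)
  exact ⟨this.1, this.2.1⟩

theorem B_mono (hB : Blocks y x N B) {h k : ℕ} (hhk : h ≤ k) (hk : k < g) : B h ≤ B k := by
  rcases hhk.lt_or_eq with h1 | rfl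
  · have := hB.sep h k h1 hk; omega
  · rfl

theorem block_jumps (H : TightWalk E w y x N) (hB : Blocks y x N B) {p q r s : ℕ}
    (hpq : p < q) (hqr : q ≤ r) (hrs : r ≤ s) (hs : s < g) :
    phase y x (B q) - phase y x (B p) + (phase y x (B s) - phase y x (B r)) ≠ 0 := by
  intro h0
  have hg := H.two_le
  rcases hrs.lt_or_eq with hrs | rfl
  · have m := fun h (hh : h < g) => H.eq_y (B_mem hB hh).2
    have := H.jump_jump (B_mono hB hpq.le (by omega)) (B_mono hB hqr (by omega))
      (B_mono hB hrs.le hs) (B_mem hB hs).1 (m p (by omega)) (m q (by omega))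
      (m r (by omega)) (m s hs) (by linear_combination h0)
    have h1 := hB.sep p q hpq (by omega)
    have h2 := hB.sep r s hrs hs
    omega
  · have := hB.inj q (by omega) p (by omega) (by linear_combination h0)
    omega

theorem phase_step (H : TightWalk E w y x N) (hB : Blocks y x N B) {h : ℕ} (hh : h + 2 < g) :
    phase y x (B (h + 2)) - phase y x (B (h + 1)) = phase y x (B (h + 1)) - phase y x (B h) := by
  obtain ⟨r, hr, e⟩ := hB.surj
    (phase y x (B h) + (phase y x (B (h + 2)) - phase y x (B (h + 1))))
  rcases lt_trichotomy r (h + 1) with h1 | rfl | h1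
  · rcases (show r ≤ h by omega).lt_or_eq with h2 | rfl
    · refine absurd ?_ (H.block_jumps hB h2 (show h ≤ h + 1 by omega)
        (show h + 1 ≤ h + 2 by omega) hh)
      rw [e]; ring
    · have := hB.inj (r + 2) hh (r + 1) (by omega) (by linear_combination -e)
      omega
  · linear_combination -e
  · refine absurd ?_ (H.block_jumps hB (show h < h + 1 by omega) (show h + 1 ≤ h + 2 by omega) h1 hr)
    rw [e]; ring

theorem phase_arith (H : TightWalk E w y x N) (hB : Blocks y x N B) {h : ℕ} (hh : h < g) :
    phase y x (B h) = phase y x (B 0) + h * (phase y x (B 1) - phase y x (B 0)) := by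
  have hstep : ∀ h, h + 1 < g → phase y x (B (h + 1)) - phase y x (B h) =
      phase y x (B 1) - phase y x (B 0) := by
    intro h
    induction h with
    | zero => intro; rfl
    | succ h ih => intro hh; rw [H.phase_step hB hh, ih (by omega)]
  induction h with
  | zero => simp
  | succ h ih =>
    push_cast
    linear_combination hstep h hh + ih (by omega)

theorem block_cut (H : TightWalk E w y x N) (hB : Blocks y x N B) {a b c d : ℕ}
    (hab : a < b) (hb : b < N) (hx : x a = x b) (hcd : c ≤ d) (hd : d < g)
    (hout : B d ≤ a ∨ b ≤ B c) :
    (b : ZMod g) - a + (phase y x (B d) - phase y x (B c)) ≠ 0 := by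
  intro h0
  have hg := H.two_le
  have m := fun h (hh : h < g) => H.eq_y (B_mem hB hh).2
  have := H.cut_jump hab (B_mono hB hcd hd) hb (B_mem hB hd).1 hout hx (m c (by omega))
    (m d hd) (by linear_combination h0)
  rcases hcd.lt_or_eq with hcd | rfl
  · have := hB.sep c d hcd hd
    omega
  · exact H.cut hab hb hx (B_mem hB hd).1 (m c hd) hout (by linear_combination h0)

/-- The position `s` lies after exactly `h` of the starting positions in `B`. -/
def InGap (g : ℕ) (B : ℕ → ℕ) (h s : ℕ) : Prop := ∀ c < g, B c < s ↔ c < h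

theorem visits (H : TightWalk E w y x N) (hB : Blocks y x N B) {u : Fin n}
    (hu : u ∉ Set.range y) : ∃ p : ZMod g, ∀ h ≤ g, ∀ s < N, x s = u → InGap g B h s →
      (s : ZMod g) = p + h * (phase y x (B 1) - phase y x (B 0)) ∧
      ∀ t < N, x t = u → InGap g B h t → t = s := by
  have : NeZero g := ⟨by have := H.two_le; omega⟩
  have hg := H.two_le
  set δ := phase y x (B 1) - phase y x (B 0) with hδ
  have ar : ∀ h < g, phase y x (B h) = phase y x (B 0) + h * δ := fun h hh => H.phase_arith hB hh
  have out0 : ∀ s t, s < t → t < N → x s = x t → t ≤ B 0 → False := by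
    intro s t hst ht hx h0
    obtain ⟨k, hk, e⟩ := hB.surj (phase y x (B 0) - (t - s))
    refine H.block_cut hB hst ht hx (Nat.zero_le k) hk (Or.inr h0) ?_
    rw [e]; ring
  have outg : ∀ s t, s < t → t < N → x s = x t → B (g - 1) ≤ s → False := by
    intro s t hst ht hx h0
    obtain ⟨k, hk, e⟩ := hB.surj (phase y x (B (g - 1)) + (t - s))
    refine H.block_cut hB hst ht hx (show k ≤ g - 1 by omega) (by omega) (Or.inl h0) ?_
    rw [e]; ring
  obtain ⟨p, q, hpq, hq, hxp, hxq, hcong, hp0, hqg⟩ : ∃ p q, p < q ∧ q < N ∧ x p = u ∧ x q = u ∧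
      (q : ZMod g) = p ∧ p < B 0 ∧ B (g - 1) < q := by
    have hcQ : (Finset.univ : Finset (ZMod g)).card <
        ((Finset.range N).filter fun i => x i = u).card := by
      rw [Finset.card_univ, ZMod.card, H.counting.1 u hu]; omega
    obtain ⟨a, ha, b, hb, hab, hf⟩ := Finset.exists_ne_map_eq_of_card_lt_of_maps_to
      (f := fun i : ℕ => (i : ZMod g)) hcQ fun _ _ => Finset.mem_univ _
    wlog hlt : a < b generalizing a b
    · exact this b hb a ha hab.symm hf.symm (by omega)
    rw [Finset.mem_filter, Finset.mem_range] at ha hb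
    have key : ∀ h < g, ¬ (B h ≤ a ∨ b ≤ B h) := fun h hh hd =>
      H.cut hlt hb.1 (ha.2.trans hb.2.symm) (B_mem hB hh).1 (H.eq_y (B_mem hB hh).2) hd
        hf.symm
    have h1 := key 0 (by omega)
    have h2 := key (g - 1) (by omega)
    exact ⟨a, b, hlt, hb.1, ha.2, hb.2, hf.symm, by omega, by omega⟩
  have gδ : (g : ZMod g) = 0 := ZMod.natCast_self g
  have val : ∀ h ≤ g, ∀ s < N, x s = u → InGap g B h s → (s : ZMod g) = p + h * δ := by
    intro h hh s hs hxs hgap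
    rcases Nat.eq_zero_or_pos h with rfl | h0
    · have h1 := hgap 0 (by omega)
      have : s = p := by
        rcases lt_trichotomy s p with h2 | h2 | h2
        · exact (out0 s p h2 (by omega) (hxs.trans hxp.symm) hp0.le).elim
        · exact h2
        · exact (out0 p s h2 hs (hxp.trans hxs.symm) (by omega)).elim
      simp [this]
    rcases hh.lt_or_eq with hh | rfl
    · have hps : p < s := hp0.trans ((hgap 0 (by omega)).2 h0)
      have hsq : s < q := by
        have := hgap (g - 1) (by omega)
        omega
      obtain ⟨k, hk, e⟩ := hB.surj (phase y x (B 0) + (s - p))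
      rw [ar k hk] at e
      rcases lt_trichotomy k h with hkh | rfl | hkh
      · refine (H.block_cut hB hsq hq (hxs.trans hxq.symm) (Nat.zero_le k) hk
          (Or.inl ((hgap k hk).2 hkh).le) ?_).elim
        rw [ar k hk, hcong]; linear_combination e
      · linear_combination -e
      · have h3 := hgap h hh
        refine (H.block_cut hB hps hs (hxp.trans hxs.symm) (show h ≤ h + (g - k) by omega)
          (by omega) (Or.inr (by omega)) ?_).elim
        rw [ar h hh, ar _ (show h + (g - k) < g by omega)]
        push_cast [Nat.cast_sub hk.le]
        linear_combination -e + δ * gδ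
    · have h1 := hgap (h - 1) (by omega)
      have : s = q := by
        rcases lt_trichotomy s q with h2 | h2 | h2
        · exact (outg s q h2 hq (hxs.trans hxq.symm) (by omega)).elim
        · exact h2
        · exact (outg q s h2 hs (hxq.trans hxs.symm) (by omega)).elim
      rw [this, hcong, gδ]; ring
  refine ⟨p, fun h hh s hs hxs hgap => ⟨val h hh s hs hxs hgap, fun t ht hxt hgt => ?_⟩⟩
  have hst := (val h hh s hs hxs hgap).trans (val h hh t ht hxt hgt).symm
  by_contra hne
  wlog hlt : s < t generalizing s t
  · exact this t ht hxt hgt s hs hxs hgap hst.symm (Ne.symm hne) (by omega)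
  rcases Nat.eq_zero_or_pos h with rfl | h0
  · have h1 := hgt 0 (by omega)
    exact out0 s t hlt ht (hxs.trans hxt.symm) (by omega)
  · exact H.cut hlt ht (hxs.trans hxt.symm) (B_mem hB (show 0 < g by omega)).1
      (H.eq_y (B_mem hB (show 0 < g by omega)).2)
      (Or.inl ((hgap 0 (by omega)).2 h0).le) hst.symm

end TightWalk
end MaxPlus

namespace MaxPlus

/-- The shape of a tight walk: `g + 1` passages through all nodes outside the cycle `y`,
separated by `g` passages through `y`. -/
structure Layout {n g : ℕ} (y : ZMod g → Fin n) (x : ℕ → Fin n) (z ε : ZMod g) : Prop where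
  outside : ∀ h ≤ g, ∀ p < n - g, x (h * n + p) ∉ Set.range y
  injOn : ∀ h ≤ g, ∀ p < n - g, ∀ q < n - g, x (h * n + p) = x (h * n + q) → p = q
  surjOn : ∀ h ≤ g, ∀ u ∉ Set.range y, ∃ p < n - g, x (h * n + p) = u
  congr : ∀ h ≤ g, ∀ k ≤ g, ∀ p < n - g, ∀ q < n - g, x (h * n + p) = x (k * n + q) →
    (p + h * ε : ZMod g) = q + k * ε
  inside : ∀ h < g, ∀ r < g, x (h * n + (n - g) + r) = y (z + h * ε + r)

namespace TightWalk

variable {n g : ℕ} {E : Fin n → Fin n → Prop} {w : Fin n → Fin n → ℝ}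
  {y : ZMod g → Fin n} {x : ℕ → Fin n} {N : ℕ} {B : ℕ → ℕ}

theorem card_outside (H : TightWalk E w y x N) :
    (Finset.univ.filter (· ∉ Set.range y)).card = n - g := by
  have : NeZero g := ⟨by have := H.two_le; omega⟩
  trans ((Finset.univ.image y)ᶜ).card
  · congr 1
    ext
    simp
  rw [Finset.card_compl, Finset.card_image_of_injective _ H.inj, Finset.card_univ, ZMod.card,
    Fintype.card_fin]

theorem gap_injOn (H : TightWalk E w y x N) (hB : Blocks y x N B) {h a b : ℕ} (hh : h ≤ g)
    (hN : b ≤ N) (hU : ∀ i, a ≤ i → i < b → x i ∉ Set.range y)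
    (hgap : ∀ i, a ≤ i → i < b → InGap g B h i) : Set.InjOn x (Finset.Ico a b) := by
  intro i hi j hj hij
  rw [Finset.mem_coe, Finset.mem_Ico] at hi hj
  obtain ⟨p, hp⟩ := H.visits hB (hU i hi.1 hi.2)
  exact ((hp h hh i (by omega) rfl (hgap i hi.1 hi.2)).2 j (by omega) hij.symm
    (hgap j hj.1 hj.2)).symm

theorem gap_image (H : TightWalk E w y x N) (hB : Blocks y x N B) {h a b : ℕ} (hh : h ≤ g)
    (hN : b ≤ N) (hU : ∀ i, a ≤ i → i < b → x i ∉ Set.range y)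
    (hgap : ∀ i, a ≤ i → i < b → InGap g B h i) :
    b - a ≤ n - g ∧ (b - a = n - g → ∀ u ∉ Set.range y, ∃ i, a ≤ i ∧ i < b ∧ x i = u) := by
  have hc := Finset.card_image_of_injOn (H.gap_injOn hB hh hN hU hgap)
  rw [Nat.card_Ico] at hc
  have hsub : (Finset.Ico a b).image x ⊆ Finset.univ.filter (· ∉ Set.range y) := by
    intro u hu
    obtain ⟨i, hi, rfl⟩ := Finset.mem_image.1 hu
    rw [Finset.mem_Ico] at hi
    exact Finset.mem_filter.2 ⟨Finset.mem_univ _, hU i hi.1 hi.2⟩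
  have hle := Finset.card_le_card hsub
  rw [H.card_outside, hc] at hle
  refine ⟨hle, fun he u hu => ?_⟩
  have := Finset.eq_of_subset_of_card_le hsub (by rw [H.card_outside, hc, he])
  have hu' : u ∈ (Finset.Ico a b).image x := by
    rw [this]; exact Finset.mem_filter.2 ⟨Finset.mem_univ _, hu⟩
  obtain ⟨i, hi, e⟩ := Finset.mem_image.1 hu'
  rw [Finset.mem_Ico] at hi
  exact ⟨i, hi.1, hi.2, e⟩

theorem gap (H : TightWalk E w y x N) (hB : Blocks y x N B) {h i : ℕ}
    (hi : i < N) (h1 : ∀ c < g, c < h → B c + g ≤ i) (h2 : ∀ c < g, h ≤ c → i < B c) :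
    x i ∉ Set.range y ∧ InGap g B h i := by
  have hg := H.two_le
  constructor
  · intro hx
    obtain ⟨c, hc, h3, h4⟩ := hB.cover i hi hx
    rcases lt_or_ge c h with h5 | h5
    · have := h1 c hc h5; omega
    · have := h2 c hc h5; omega
  · intro c hc
    rcases lt_or_ge c h with h5 | h5
    · have := h1 c hc h5; omega
    · have := h2 c hc h5; omega

theorem B_eq (H : TightWalk E w y x N) (hB : Blocks y x N B) {h : ℕ} (hh : h < g) :
    B h = h * n + (n - g) := by
  have hg := H.two_le
  have hn := H.le_n
  have hN := H.card
  have mono := fun h k => B_mono (h := h) (k := k) hB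
  have b0 : B 0 ≤ n - g := by
    have hgp := fun i (_ : 0 ≤ i) (hi : i < B 0) => H.gap hB (h := 0)
      (hi.trans (B_mem hB (by omega)).1) (by omega)
      (fun c hc _ => hi.trans_le (mono 0 c (Nat.zero_le c) hc))
    simpa using (H.gap_image hB (Nat.zero_le g) (B_mem hB (by omega)).1.le
      (fun i h1 h2 => (hgp i h1 h2).1) (fun i h1 h2 => (hgp i h1 h2).2)).1
  have bs : ∀ h, h + 1 < g → B (h + 1) ≤ B h + n := by
    intro h hh
    have hgp := fun i (hi' : B h + g ≤ i) (hi : i < B (h + 1)) => H.gap hB (h := h + 1)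
      (hi.trans (B_mem hB (by omega)).1)
      (fun c hc hch => by have := mono c h (by omega) (by omega); omega)
      (fun c hc hch => hi.trans_le (mono _ c hch hc))
    have := (H.gap_image hB hh.le (B_mem hB hh).1.le
      (fun i h1 h2 => (hgp i h1 h2).1) (fun i h1 h2 => (hgp i h1 h2).2)).1
    omega
  have bl : N ≤ B (g - 1) + n := by
    have hgp := fun i (hi' : B (g - 1) + g ≤ i) (hi : i < N) => H.gap hB (h := g) hi
      (fun c hc hch => by have := mono c (g - 1) (by omega) (by omega); omega)
      (fun c hc hch => by omega)
    have := (H.gap_image hB le_rfl le_rfl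
      (fun i h1 h2 => (hgp i h1 h2).1) (fun i h1 h2 => (hgp i h1 h2).2)).1
    omega
  have up : ∀ h < g, B h ≤ h * n + (n - g) := by
    intro h
    induction h with
    | zero => intro; simpa using b0
    | succ h ih =>
      intro hh
      have := ih (by omega)
      have := bs h hh
      rw [Nat.succ_mul]; omega
  have dn : ∀ k < g, N ≤ B (g - 1 - k) + (k + 1) * n := by
    intro k
    induction k with
    | zero => intro; simpa using bl
    | succ k ih =>
      intro hk
      have h1 := ih (by omega)
      have h2 := bs (g - 1 - (k + 1)) (by omega)
      rw [show g - 1 - (k + 1) + 1 = g - 1 - k by omega] at h2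
      rw [Nat.succ_mul]; omega
  have h1 := up h hh
  have h2 := dn (g - 1 - h) (by omega)
  rw [show g - 1 - (g - 1 - h) = h by omega] at h2
  have h3 : (g - 1 - h + 1) * n + h * n = g * n := by rw [← Nat.add_mul]; congr 1; omega
  omega

theorem exists_layout (H : TightWalk E w y x N) : ∃ z ε, Layout y x z ε := by
  obtain ⟨B, hB⟩ := H.exists_blocks
  have hg := H.two_le
  have hn := H.le_n
  have hN := H.card
  have beq := fun h (hh : h < g) => H.B_eq hB hh
  have hlt : ∀ h ≤ g, ∀ p < n - g, h * n + p < N := by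
    intro h hh p hp
    have := Nat.mul_le_mul_right n hh
    omega
  have hgp : ∀ h ≤ g, ∀ i, h * n ≤ i → i < h * n + (n - g) →
      x i ∉ Set.range y ∧ InGap g B h i := by
    intro h hh i h1 h2
    have := hlt h hh (i - h * n) (by omega)
    refine H.gap hB (by omega) (fun c hc hch => ?_) (fun c hc hch => ?_)
    · have := Nat.mul_le_mul_right n (show c + 1 ≤ h from hch)
      rw [Nat.succ_mul] at this
      rw [beq c hc]; omega
    · have := Nat.mul_le_mul_right n hch
      rw [beq c hc]; omega
  have hend : ∀ h ≤ g, h * n + (n - g) ≤ N := by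
    intro h hh
    have := Nat.mul_le_mul_right n hh
    omega
  refine ⟨n - phase y x (B 0), n - (phase y x (B 1) - phase y x (B 0)), ?_, ?_, ?_, ?_, ?_⟩
  · intro h hh p hp
    exact (hgp h hh _ (by omega) (by omega)).1
  · intro h hh p hp q hq hpq
    have := H.gap_injOn hB hh (hend h hh) (fun i h1 h2 => (hgp h hh i h1 h2).1)
      (fun i h1 h2 => (hgp h hh i h1 h2).2) (by simpa using hp) (by simpa using hq) hpq
    omega
  · intro h hh u hu
    obtain ⟨i, h1, h2, h3⟩ := (H.gap_image hB hh (hend h hh) (fun i h1 h2 => (hgp h hh i h1 h2).1)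
      (fun i h1 h2 => (hgp h hh i h1 h2).2)).2 (by omega) u hu
    exact ⟨i - h * n, by omega, by rwa [Nat.add_sub_cancel' h1]⟩
  · intro h hh k hk p hp q hq hpq
    have g1 := hgp h hh (h * n + p) (by omega) (by omega)
    have g2 := hgp k hk (k * n + q) (by omega) (by omega)
    obtain ⟨c, hc⟩ := H.visits hB g1.1
    have e1 := (hc h hh _ (hlt h hh p hp) rfl g1.2).1
    have e2 := (hc k hk _ (hlt k hk q hq) hpq.symm g2.2).1
    push_cast at e1 e2
    linear_combination e1 - e2
  · intro h hh r hr
    have := hB.mem h hh (h * n + (n - g) + r) (by rw [beq h hh]; omega)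
      (by rw [beq h hh]; omega)
    rw [H.eq_y this.2.1, this.2.2, H.phase_arith hB hh]
    congr 1
    push_cast [Nat.cast_sub hn]
    rw [ZMod.natCast_self]
    ring

end TightWalk
end MaxPlus

namespace MaxPlus
namespace TightWalk

variable {n g : ℕ} {E : Fin n → Fin n → Prop} {w : Fin n → Fin n → ℝ}
  {y : ZMod g → Fin n} {x : ℕ → Fin n} {N : ℕ} {z ε : ZMod g}

/-- The segment from `p` to `q`, which contains an excursion from `a` to `b`, is replaced by the
excursion from `c` to `d`, joined to its endpoints by arcs of the cycle. -/
theorem exchange (H : TightWalk E w y x N) {p a b q c d : ℕ} {cp ca cb cq cc cd : ZMod g}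
    (hpa : p ≤ a) (hab : a ≤ b) (hbq : b ≤ q) (hq : q < N) (hcd : c ≤ d) (hd : d < N)
    (ep : x p = y cp) (ea : x a = y ca) (eb : x b = y cb) (eq : x q = y cq)
    (ec : x c = y cc) (ed : x d = y cd)
    (hl : cc - cp + (d - c) + (cq - cd) = (q : ZMod g) - p)
    (hlen : (d - c) + 2 * (g - 1) ≤ q - p) (hne : cc - cp ≠ -1) :
    partialW w x d - partialW w x c < partialW w x b - partialW w x a := by
  obtain ⟨l₁, hl₁, e₁, h₁⟩ := H.walk_y_to cp cc
  obtain ⟨l₂, hl₂, e₂, h₂⟩ := H.walk_y_to cd cq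
  have hl₁' : l₁ ≠ g - 1 := by
    rintro rfl
    rw [Nat.cast_sub (by omega), ZMod.natCast_self] at e₁
    exact hne (by rw [← e₁]; simp)
  by_contra hlt
  have n1 := H.nonpos_x hpa (by omega) ep ea
  have n2 := H.nonpos_x hbq hq eb eq
  rw [← ep, ← ec] at h₁
  rw [← ed, ← eq] at h₂
  have := H.splice (hpa.trans (hab.trans hbq)) le_rfl le_rfl hq
    ((h₁.trans (H.sub hcd hd)).trans h₂) (WalkW.nil (x q)) (by linarith)
    (by push_cast [Nat.cast_sub hcd]; linear_combination hl + e₁ + e₂)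
    ⟨p, by omega, ⟨cp, ep.symm⟩, Or.inl le_rfl⟩
  omega

theorem shift_eq_zero_of_three_le (H : TightWalk E w y x N) (L : Layout y x z ε) (hg : 3 ≤ g) :
    ε = 0 := by
  by_contra hε
  have hn := H.le_n
  have hN := H.card
  have h3 := Nat.mul_le_mul_right n hg
  have gc : (g : ZMod g) = 0 := ZMod.natCast_self g
  have gc' : ((g - 1 : ℕ) : ZMod g) = -1 := by
    rw [Nat.cast_sub (by omega), gc]; simp
  have s : ∀ h < 3, x (h * n + (n - g)) = y (z + h * ε) := by
    intro h hh
    simpa using L.inside h (by omega) 0 (by omega)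
  have t : ∀ h < 3, x (h * n + (n - 1)) = y (z + h * ε - 1) := by
    intro h hh
    have := L.inside h (by omega) (g - 1) (by omega)
    rw [gc', ← sub_eq_add_neg] at this
    rw [← this]; congr 1; omega
  have c1 : ((n - 1 : ℕ) : ZMod g) = n - 1 := by rw [Nat.cast_sub (by omega)]; simp
  have c2 : ((n - g : ℕ) : ZMod g) = n := by rw [Nat.cast_sub hn, gc]; simp
  have i1 := H.exchange (p := 0 * n + (n - g)) (a := 0 * n + (n - 1)) (b := 1 * n + (n - g))
    (q := 1 * n + (n - 1)) (c := 1 * n + (n - 1)) (d := 2 * n + (n - g))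
    (by omega) (by omega) (by omega) (by omega) (by omega) (by omega)
    (s 0 (by omega)) (t 0 (by omega)) (s 1 (by omega)) (t 1 (by omega)) (t 1 (by omega))
    (s 2 (by omega)) (by push_cast [c1, c2]; ring) (by omega)
    (fun h => hε (by push_cast at h; linear_combination h))
  have i2 := H.exchange (p := 1 * n + (n - g)) (a := 1 * n + (n - 1)) (b := 2 * n + (n - g))
    (q := 2 * n + (n - 1)) (c := 0 * n + (n - 1)) (d := 1 * n + (n - g))
    (by omega) (by omega) (by omega) (by omega) (by omega) (by omega)
    (s 1 (by omega)) (t 1 (by omega)) (s 2 (by omega)) (t 2 (by omega)) (t 0 (by omega))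
    (s 1 (by omega)) (by push_cast [c1, c2]; ring) (by omega)
    (fun h => hε (by push_cast at h; linear_combination -h))
  linarith

theorem shift_eq_zero_of_two {y : ZMod 2 → Fin n} {z ε : ZMod 2} (H : TightWalk E w y x N)
    (L : Layout y x z ε) (hn : 3 ≤ n) : ε = 0 := by
  by_contra hε
  obtain rfl : ε = 1 := (show ∀ a : ZMod 2, a ≠ 0 → a = 1 by decide) ε hε
  have hN := H.card
  have two : (2 : ZMod 2) = 0 := rfl
  have e0 := L.inside 0 (by omega) 0 (by omega)
  have e1 := L.inside 0 (by omega) 1 (by omega)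
  have e2 := L.inside 1 (by omega) 0 (by omega)
  have e3 := L.inside 1 (by omega) 1 (by omega)
  obtain ⟨q, hq, eq⟩ := L.surjOn 1 (by omega) _ (L.outside 2 (by omega) 0 (by omega))
  obtain ⟨s, hs, es⟩ := L.surjOn 2 (by omega) _ (L.outside 1 (by omega) 0 (by omega))
  have cq := L.congr _ (by omega) _ (by omega) _ hq _ (by omega) eq
  have cs := L.congr _ (by omega) _ (by omega) _ hs _ (by omega) es
  push_cast at e0 e1 e2 e3 cq cs
  have h₁ := WalkW.single (w := w) (H.arc_x (2 * n - 1) (by omega))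
  have h₂ := WalkW.single (w := w) (H.arc_x (n - 1) (by omega))
  have w₁ := partialW_succ (w := w) x (2 * n - 1)
  have w₂ := partialW_succ (w := w) x (n - 1)
  rw [show 2 * n - 1 + 1 = 2 * n by omega] at h₁ w₁
  rw [show n - 1 + 1 = n by omega] at h₂ w₂
  rw [show 0 * n + (n - 2) + 0 = n - 2 by omega] at e0
  rw [show 0 * n + (n - 2) + 1 = n - 1 by omega] at e1
  rw [show 1 * n + (n - 2) + 0 = 2 * n - 2 by omega] at e2
  rw [show 1 * n + (n - 2) + 1 = 2 * n - 1 by omega] at e3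
  rw [one_mul, add_zero] at eq es
  have n1 := H.nonpos_x (show n - 2 ≤ n - 1 by omega) (by omega) e0 e1
  have n2 := H.nonpos_x (show 2 * n - 2 ≤ 2 * n - 1 by omega) (by omega) e2 e3
  have c1 := H.sub (show n ≤ n + q by omega) (by omega)
  have c2 := H.sub (show 2 * n ≤ 2 * n + s by omega) (by omega)
  rw [eq] at c1
  rw [es] at c2
  have n3 := H.closed _ _ _ (c1.trans c2)
  have j1 : x (2 * n - 1) = x (n - 2) := by
    rw [e0, e3]; congr 1; linear_combination two
  have j2 : x (n - 1) = x (2 * n - 2) := by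
    rw [e1, e2]; congr 1; ring
  have hw : partialW w x (n + q) - partialW w x (n - 2) +
      (partialW w x (2 * n + s) - partialW w x (2 * n - 2)) ≤
      w (x (2 * n - 1)) (x (2 * n)) + w (x (n - 1)) (x n) := by linarith
  rw [j1, ← eq] at h₁
  rw [j2, ← es] at h₂
  rw [j1, j2, ← eq, ← es] at hw
  have := H.splice (show n - 2 ≤ n + q by omega) (show n + q ≤ 2 * n - 2 by omega)
    (show 2 * n - 2 ≤ 2 * n + s by omega) (by omega) h₁ h₂ hw (by
      push_cast [Nat.cast_sub (show 2 ≤ n by omega), Nat.cast_sub (show 2 ≤ 2 * n by omega)]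
      linear_combination -cs - cq - two)
    ⟨n - 2, by omega, ⟨_, e0.symm⟩, Or.inl le_rfl⟩
  omega

theorem shift_eq_zero (H : TightWalk E w y x N) (L : Layout y x z ε) (hne : ¬(n = 2 ∧ g = 2)) :
    ε = 0 := by
  have hg := H.two_le
  have hn := H.le_n
  rcases hg.lt_or_eq with hg | rfl
  · exact H.shift_eq_zero_of_three_le L hg
  · exact H.shift_eq_zero_of_two L (by omega)

end TightWalk
end MaxPlus

namespace MaxPlus
namespace TightWalk

variable {n g : ℕ} {E : Fin n → Fin n → Prop} {w : Fin n → Fin n → ℝ}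
  {y : ZMod g → Fin n} {x : ℕ → Fin n} {N : ℕ} {z : ZMod g}

/-- Two segments with a common first node are replaced by each other's first arc. -/
theorem swap_heads (H : TightWalk E w y x N) {p q r s k : ℕ} (hpq : p < q) (hqk : q ≤ k)
    (hkr : k ≤ r) (hrs : r < s) (hs : s < N) (hk : x k ∈ Set.range y) (hpr : x p = x r)
    (hq : x q = x (r + 1)) (hxs : x s = x (p + 1))
    (h : (q : ZMod g) - (p + 1 : ℕ) + (s - (r + 1 : ℕ)) = 0) : q = p + 1 ∧ s = r + 1 := by
  have h₁ := WalkW.single (w := w) (H.arc_x r (by omega))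
  have h₂ := WalkW.single (w := w) (H.arc_x p (by omega))
  have w₁ := partialW_succ (w := w) x r
  have w₂ := partialW_succ (w := w) x p
  have c1 := H.sub (show p + 1 ≤ q by omega) (by omega)
  have c2 := H.sub (show r + 1 ≤ s by omega) (by omega)
  rw [hq] at c1
  rw [hxs] at c2
  have n3 := H.closed _ _ _ (c1.trans c2)
  have hw : partialW w x q - partialW w x p + (partialW w x s - partialW w x r) ≤
      w (x r) (x (r + 1)) + w (x p) (x (p + 1)) := by linarith
  rw [← hpr, ← hq] at h₁
  rw [hpr, ← hxs] at h₂
  rw [← hpr, ← hq, ← hxs] at hw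
  nth_rewrite 2 [hpr] at hw
  have := H.splice hpq.le (hqk.trans hkr) hrs.le hs h₁ h₂ hw
    (by push_cast at h ⊢; linear_combination -h) ⟨k, by omega, hk, Or.inr (Or.inl ⟨hqk, hkr⟩)⟩
  omega

/-- Two segments with a common last node are replaced by each other's last arc. -/
theorem swap_tails (H : TightWalk E w y x N) {p q r s k : ℕ} (hpq : p ≤ q) (hqk : q < k)
    (hkr : k ≤ r) (hrs : r ≤ s) (hs : s + 1 < N) (hk : x k ∈ Set.range y)
    (hqs : x (q + 1) = x (s + 1)) (hp : x p = x s) (hr : x r = x q)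
    (h : (q : ZMod g) - p + (s - r) = 0) : p = q ∧ r = s := by
  have h₁ := WalkW.single (w := w) (H.arc_x s (by omega))
  have h₂ := WalkW.single (w := w) (H.arc_x q (by omega))
  have w₁ := partialW_succ (w := w) x s
  have w₂ := partialW_succ (w := w) x q
  have c1 := H.sub hpq (by omega)
  have c2 := H.sub hrs (by omega)
  rw [← hr] at c1
  rw [← hp] at c2
  have n3 := H.closed _ _ _ (c1.trans c2)
  have hw : partialW w x (q + 1) - partialW w x p + (partialW w x (s + 1) - partialW w x r) ≤
      w (x s) (x (s + 1)) + w (x q) (x (q + 1)) := by linarith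
  rw [← hp, ← hqs] at h₁
  rw [← hr, hqs] at h₂
  rw [← hp, ← hr, ← hqs] at hw
  nth_rewrite 2 [hqs] at hw
  have := H.splice (show p ≤ q + 1 by omega) (show q + 1 ≤ r by omega)
    (show r ≤ s + 1 by omega) hs h₁ h₂ hw
    (by push_cast at h ⊢; linear_combination -h)
    ⟨k, by omega, hk, Or.inr (Or.inl ⟨by omega, hkr⟩)⟩
  omega

theorem periodic_inside (L : Layout y x z 0) {h t : ℕ} (hh : h + 1 < g) (ht : n - g ≤ t)
    (htn : t < n - g + g) : x ((h + 1) * n + t) = x (h * n + t) := by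
  have h1 := L.inside h (by omega) (t - (n - g)) (by omega)
  have h2 := L.inside (h + 1) hh (t - (n - g)) (by omega)
  rw [mul_zero, add_assoc (_ * n), Nat.add_sub_cancel' ht] at h1 h2
  rw [h1, h2]

theorem periodic_succ (H : TightWalk E w y x N) (L : Layout y x z 0) {h : ℕ} (hh : h + 2 ≤ g)
    (t : ℕ) : t < n - g → x ((h + 2) * n + t) = x ((h + 1) * n + t) := by
  have hn := H.le_n
  have hN := H.card
  have hg := H.two_le
  have hm := Nat.mul_le_mul_right n hh
  have m1 : (h + 1) * n = h * n + n := Nat.succ_mul h n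
  have m2 : (h + 2) * n = h * n + n + n := by rw [Nat.succ_mul, m1]
  induction t using Nat.strong_induction_on with
  | _ t ih =>
    intro ht
    by_contra hab
    have hprev : x ((h + 1) * n + t - 1) = x ((h + 2) * n + t - 1) := by
      rcases Nat.eq_zero_or_pos t with rfl | h0
      · have := periodic_inside L (h := h) (t := n - 1) (by omega) (by omega) (by omega)
        convert this.symm using 2 <;> omega
      · have := ih (t - 1) (by omega) (by omega)
        convert this.symm using 2 <;> omega
    obtain ⟨q, hq, eq⟩ := L.surjOn (h + 1) (by omega) _ (L.outside (h + 2) hh t ht)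
    obtain ⟨s, hs, es⟩ := L.surjOn (h + 2) (by omega) _ (L.outside (h + 1) (by omega) t ht)
    have cq := L.congr _ (by omega) _ hh _ hq _ ht eq
    have cs := L.congr _ hh _ (by omega) _ hs _ ht es
    have hqt : t ≤ q := by
      by_contra hlt
      have := L.injOn _ hh _ hq _ ht ((ih q (by omega) hq).trans eq)
      omega
    have hst : t ≤ s := by
      by_contra hlt
      have := L.injOn _ (by omega) _ hs _ ht ((ih s (by omega) hs).symm.trans es)
      omega
    have hk := L.inside (h + 1) (by omega) 0 (by omega)
    have e1 : (h + 1) * n + t - 1 + 1 = (h + 1) * n + t := by omega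
    have e2 : (h + 2) * n + t - 1 + 1 = (h + 2) * n + t := by omega
    have := H.swap_heads (p := (h + 1) * n + t - 1) (q := (h + 1) * n + q)
      (r := (h + 2) * n + t - 1) (s := (h + 2) * n + s) (k := (h + 1) * n + (n - g) + 0)
      (by omega) (by omega) (by omega) (by omega) (by omega) ⟨_, hk.symm⟩ hprev
      (by rw [e2, eq]) (by rw [e1, es])
      (by rw [e1, e2]; push_cast; linear_combination cq + cs)
    obtain rfl : q = t := by omega
    exact hab eq.symm

theorem periodic_zero (H : TightWalk E w y x N) (L : Layout y x z 0) (d : ℕ) :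
    ∀ t, t + d + 1 = n - g → x (n + t) = x t := by
  have hn := H.le_n
  have hN := H.card
  have hg := H.two_le
  have hm := Nat.mul_le_mul_right n hg
  induction d using Nat.strong_induction_on with
  | _ d ih =>
    intro t htd
    have ht : t < n - g := by omega
    have ih' : ∀ s, t < s → s < n - g → x (1 * n + s) = x (0 * n + s) := fun s hs hsn => by
      simpa using ih (n - g - s - 1) (by omega) s (by omega)
    by_contra hab
    have hnext : x (t + 1) = x (n + t + 1) := by
      rcases Nat.eq_zero_or_pos d with rfl | h0
      · have := periodic_inside L (h := 0) (t := n - g) (by omega) (by omega) (by omega)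
        convert this.symm using 2 <;> omega
      · have := ih' (t + 1) (by omega) (by omega)
        convert this.symm using 2 <;> omega
    obtain ⟨p, hp, ep⟩ := L.surjOn 0 (by omega) _ (L.outside 1 (by omega) t ht)
    obtain ⟨r, hr, er⟩ := L.surjOn 1 (by omega) _ (L.outside 0 (by omega) t ht)
    have cp := L.congr _ (by omega) _ (by omega) _ hp _ ht ep
    have cr := L.congr _ (by omega) _ (by omega) _ hr _ ht er
    have hpt : p ≤ t := by
      by_contra hlt
      have := L.injOn _ (by omega) _ hp _ ht ((ih' p (by omega) hp).trans ep)
      omega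
    have hrt : r ≤ t := by
      by_contra hlt
      have := L.injOn _ (by omega) _ hr _ ht ((ih' r (by omega) hr).symm.trans er)
      omega
    have hk := L.inside 0 (by omega) 0 (by omega)
    rw [one_mul, zero_mul, zero_add] at ep er
    have := H.swap_tails (p := p) (q := t) (r := n + r) (s := n + t)
      (k := 0 * n + (n - g) + 0)
      hpt (by omega) (by omega) (by omega) (by omega) ⟨_, hk.symm⟩ hnext ep er
      (by push_cast; linear_combination -cp - cr)
    obtain rfl : p = t := this.1
    exact hab ep.symm

theorem periodic (H : TightWalk E w y x N) (L : Layout y x z 0) {i : ℕ} (hi : i + n < N) :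
    x (i + n) = x i := by
  have hn := H.le_n
  have hN := H.card
  have hg := H.two_le
  have hmod := Nat.mod_lt i (show 0 < n by omega)
  have hdiv := Nat.div_add_mod' i n
  generalize i / n = h at hdiv
  generalize i % n = t at hdiv hmod
  subst hdiv
  rw [show h * n + t + n = (h + 1) * n + t by rw [Nat.succ_mul]; omega] at hi ⊢
  rcases lt_or_ge t (n - g) with ht | ht
  · have hh : h + 1 ≤ g := by
      by_contra hlt
      have := Nat.mul_le_mul_right n (show g + 1 ≤ h + 1 by omega)
      rw [Nat.succ_mul g] at this
      omega
    rcases h with - | h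
    · simpa using H.periodic_zero L (n - g - t - 1) t (by omega)
    · exact H.periodic_succ L hh t ht
  · refine periodic_inside L ?_ ht (by omega)
    by_contra hlt
    have := Nat.mul_le_mul_right n (show g ≤ h + 1 by omega)
    omega

/-- A tight walk turns around a Hamiltonian cycle, which consists of the cycle `y` followed by
the remaining nodes. -/
theorem hamiltonian (H : TightWalk E w y x N) (hne : ¬(n = 2 ∧ g = 2)) :
    (∀ i, i + n < N → x (i + n) = x i) ∧
    (∀ i < n, ∀ j < n, x (n - g + i) = x (n - g + j) → i = j) ∧
    ∀ i < n, x (n - g + i) ∈ Set.range y ↔ i < g := by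
  obtain ⟨z, ε, L⟩ := H.exists_layout
  obtain rfl := H.shift_eq_zero L hne
  have hg := H.two_le
  have hn := H.le_n
  have inside : ∀ i < g, x (n - g + i) = y (z + i) := by
    intro i hi
    simpa using L.inside 0 (by omega) i hi
  have outside : ∀ i < n, g ≤ i → x (n - g + i) = x (1 * n + (i - g)) := by
    intro i hi hgi
    congr 1; omega
  have iff : ∀ i < n, x (n - g + i) ∈ Set.range y ↔ i < g := by
    intro i hi
    refine ⟨fun h => ?_, fun h => ⟨_, (inside i h).symm⟩⟩
    by_contra hlt
    rw [outside i hi (by omega)] at h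
    exact L.outside 1 (by omega) _ (by omega) h
  refine ⟨fun i => H.periodic L, fun i hi j hj hij => ?_, iff⟩
  have hij' : i < g ↔ j < g := by rw [← iff i hi, hij, iff j hj]
  rcases lt_or_ge i g with h | h
  · have hj' := hij'.1 h
    rw [inside i h, inside j hj'] at hij
    have := add_left_cancel (H.inj hij)
    rwa [ZMod.natCast_eq_natCast_iff', Nat.mod_eq_of_lt h, Nat.mod_eq_of_lt hj'] at this
  · have hj' : g ≤ j := by omega
    rw [outside i hi h, outside j hj hj'] at hij
    have := L.injOn 1 (by omega) _ (by omega) _ (by omega) hij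
    omega

end TightWalk
end MaxPlus

namespace MaxPlus

section Sequences

variable {V : Type*} {E : V → V → Prop} {w : V → V → ℝ}

theorem WalkW.exists_seq_append {l₁ l₂ : ℕ} {r₁ : ℝ} {a c : V} (h : WalkW E w l₁ r₁ a c)
    {x₂ : ℕ → V} (h₀ : x₂ 0 = c) (h₂ : ∀ k < l₂, E (x₂ k) (x₂ (k + 1))) :
    ∃ x : ℕ → V, x 0 = a ∧ x l₁ = c ∧ x (l₁ + l₂) = x₂ l₂ ∧
      (∀ k < l₁ + l₂, E (x k) (x (k + 1))) ∧
      partialW w x (l₁ + l₂) = r₁ + partialW w x₂ l₂ := by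
  induction h with
  | nil a => exact ⟨x₂, h₀, h₀, by rw [zero_add], by rwa [zero_add], by rw [zero_add, zero_add]⟩
  | @cons a b c l r hab _ ih =>
    obtain ⟨x, hx0, hxl, hxe, hE, hp⟩ := ih h₀
    refine ⟨fun k => Nat.casesOn k a x, rfl, hxl, ?_, ?_, ?_⟩
    · rw [Nat.add_right_comm]; exact hxe
    · rw [Nat.add_right_comm]
      rintro (- | k) hk
      · simpa [hx0] using hab
      · exact hE k (by omega)
    · rw [Nat.add_right_comm, partialW, Finset.sum_range_succ', add_comm (w a b) r,
        add_right_comm, ← hp]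
      simp [partialW, hx0]

theorem WalkW.exists_seq {l : ℕ} {r : ℝ} {a b : V} (h : WalkW E w l r a b) :
    ∃ x : ℕ → V, x 0 = a ∧ x l = b ∧ (∀ k < l, E (x k) (x (k + 1))) ∧ partialW w x l = r := by
  obtain ⟨x, h0, h1, -, h2, h3⟩ :=
    h.exists_seq_append (l₂ := 0) (x₂ := fun _ => b) rfl (by simp)
  exact ⟨x, h0, h1, h2, by simpa [partialW] using h3⟩

theorem WalkW.potential {φ : V → ℝ} {l : ℕ} {r : ℝ} {a b : V}
    (h : WalkW E (fun u v => w u v + φ u - φ v) l r a b) : WalkW E w l (r - φ a + φ b) a b := by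
  induction h with
  | nil a => simpa using WalkW.nil a
  | cons h _ ih =>
    convert WalkW.cons h ih using 1
    ring

theorem partialW_potential (φ : V → ℝ) (x : ℕ → V) (k : ℕ) :
    partialW (fun u v => w u v + φ u - φ v) x k = partialW w x k + φ (x 0) - φ (x k) := by
  induction k with
  | zero => simp [partialW]
  | succ k ih => rw [partialW_succ, partialW_succ, ih]; ring

/-- If all simple closed walks have nonpositive weight, then so do all closed walks. -/
theorem WalkW.closed_nonpos
    (hcyc : ∀ l (x : ℕ → V), 0 < l → (∀ k < l, E (x k) (x (k + 1))) → x 0 = x l →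
      Set.InjOn x (Set.Iio l) → partialW w x l ≤ 0)
    (l : ℕ) : ∀ r a, WalkW E w l r a a → r ≤ 0 := by
  induction l using Nat.strong_induction_on with
  | _ l ih =>
    intro r a h
    obtain ⟨x, h0, hl, hE, rfl⟩ := h.exists_seq
    rcases Nat.eq_zero_or_pos l with rfl | hpos
    · simp [partialW]
    by_cases hinj : Set.InjOn x (Set.Iio l)
    · exact hcyc l x hpos hE (h0.trans hl.symm) hinj
    obtain ⟨i, hi, j, hj, hij, hne⟩ : ∃ i, i < l ∧ ∃ j, j < l ∧ x i = x j ∧ i ≠ j := by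
      simpa [Set.InjOn] using hinj
    wlog hlt : i < j generalizing i j
    · exact this j hj i hi hij.symm hne.symm (by omega)
    have w1 := WalkW.of_seq (w := w) (x := x) (Nat.zero_le i) fun k _ hk => hE k (by omega)
    have w2 := WalkW.of_seq (w := w) (x := x) hlt.le fun k _ hk => hE k (by omega)
    have w3 := WalkW.of_seq (w := w) (x := x) hj.le fun k _ hk => hE k (by omega)
    rw [hij] at w1 w2
    rw [hl] at w3
    rw [h0] at w1
    have n1 := ih _ (by omega) _ _ w2
    have n2 := ih _ (by omega) _ _ (w1.trans w3)
    have : partialW w x 0 = 0 := by simp [partialW]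
    linarith

end Sequences

section Lists

variable {n : ℕ} {A : Mat n}

theorem exists_map_range (W : List (Fin n)) (hW : W ≠ []) :
    ∃ x : ℕ → Fin n, W = (List.range W.length).map x := by
  refine ⟨fun k => W.getD k (W.head hW), List.ext_getElem (by simp) fun i h1 h2 => ?_⟩
  simp [List.getElem?_eq_getElem h1]

theorem isChain_map_range {R : Fin n → Fin n → Prop} {x : ℕ → Fin n} {N : ℕ} :
    ((List.range N).map x).IsChain R ↔ ∀ k, k + 1 < N → R (x k) (x (k + 1)) := by
  simp [List.isChain_iff_getElem]

theorem head?_map_range (x : ℕ → Fin n) (N : ℕ) :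
    ((List.range (N + 1)).map x).head? = some (x 0) := by
  simp [List.head?_range]

theorem getLast?_map_range (x : ℕ → Fin n) (N : ℕ) :
    ((List.range (N + 1)).map x).getLast? = some (x N) := by
  simp [List.getLast?_range]

theorem dropLast_map_range (x : ℕ → Fin n) (N : ℕ) :
    ((List.range (N + 1)).map x).dropLast = (List.range N).map x := by
  simp [List.range_succ]

theorem nodup_map_range {x : ℕ → Fin n} {N : ℕ} :
    ((List.range N).map x).Nodup ↔ Set.InjOn x (Set.Iio N) := by
  rw [List.nodup_map_iff_inj_on List.nodup_range]
  simp [Set.InjOn]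

theorem isCycle_map_range {R : Fin n → Fin n → Prop} {x : ℕ → Fin n} {N : ℕ} :
    IsCycle R ((List.range (N + 1)).map x) ↔
      0 < N ∧ (∀ k < N, R (x k) (x (k + 1))) ∧ x 0 = x N ∧ Set.InjOn x (Set.Iio N) := by
  refine and_congr (by simp; omega) (and_congr ?_ (and_congr ?_ ?_))
  · exact isChain_map_range.trans (by simp)
  · rw [head?_map_range, getLast?_map_range, Option.some_inj]
  · rw [dropLast_map_range, nodup_map_range]

/-- The real weight of an arc. -/
def realW (A : Mat n) (i j : Fin n) : ℝ := (A i j).unbotD 0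

theorem coe_realW {i j : Fin n} (h : arc A i j) : (realW A i j : Rmax) = A i j := by
  obtain ⟨r, hr⟩ := WithBot.ne_bot_iff_exists.1 h
  rw [realW, ← hr]; rfl

theorem weight_map_range (N : ℕ) : ∀ x : ℕ → Fin n, (∀ k < N, arc A (x k) (x (k + 1))) →
    weight A ((List.range (N + 1)).map x) = (partialW (realW A) x N : ℝ) := by
  induction N with
  | zero => intro x _; simp [weight, partialW]
  | succ N ih =>
    intro x hx
    have h1 := ih (fun k => x (k + 1)) fun k hk => hx (k + 1) (by omega)
    have h2 : weight A ((List.range (N + 1 + 1)).map x) =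
        A (x 0) (x 1) + weight A ((List.range (N + 1)).map fun k => x (k + 1)) := by
      rw [List.range_succ_eq_map, List.map_cons, List.map_map, List.range_succ_eq_map,
        List.map_cons, List.map_cons]
      rfl
    rw [h2, h1, ← coe_realW (hx 0 (by omega)), partialW, partialW, Finset.sum_range_succ']
    norm_cast
    rw [add_comm]

theorem len_map_range (x : ℕ → Fin n) (N : ℕ) : len ((List.range (N + 1)).map x) = N := by
  simp [len]

theorem mean_map_range {N : ℕ} {x : ℕ → Fin n} (hx : ∀ k < N, arc A (x k) (x (k + 1))) :
    mean A ((List.range (N + 1)).map x) = ((partialW (realW A) x N / N : ℝ) : Rmax) := by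
  rw [mean, weight_map_range N x hx, len_map_range]; rfl

theorem isWalkFrom_map_range {R : Fin n → Fin n → Prop} {x : ℕ → Fin n} {N : ℕ}
    (hx : ∀ k < N, R (x k) (x (k + 1))) :
    IsWalkFrom R ((List.range (N + 1)).map x) (x 0) (x N) :=
  ⟨⟨by simp, isChain_map_range.2 fun k hk => hx k (by omega)⟩, head?_map_range x N,
    getLast?_map_range x N⟩

theorem finite_isCycle (R : Fin n → Fin n → Prop) : {W | IsCycle R W}.Finite := by
  refine (List.finite_length_le (Fin n) (n + 1)).subset fun W hW => ?_
  have := hW.2.2.2.length_le_card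
  rw [List.length_dropLast, Fintype.card_fin] at this
  show W.length ≤ n + 1
  omega

theorem mean_le_lam {W : List (Fin n)} (hW : IsCycle (arc A) W) : mean A W ≤ lam A := by
  refine le_csSup (Set.Finite.bddAbove ?_) ⟨W, hW, rfl⟩
  refine ((finite_isCycle (arc A)).image (mean A)).subset ?_
  rintro m ⟨V, hV, rfl⟩
  exact ⟨V, hV, rfl⟩

theorem closed_nonpos (hlam : lam A = 0) {l : ℕ} {r : ℝ} {a : Fin n}
    (h : WalkW (arc A) (realW A) l r a a) : r ≤ 0 := by
  refine WalkW.closed_nonpos (fun l x hl hE hx hinj => ?_) l r a h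
  have := mean_le_lam (isCycle_map_range.2 ⟨hl, hE, hx, hinj⟩)
  rw [mean_map_range hE, hlam, ← WithBot.coe_zero, WithBot.coe_le_coe,
    div_le_iff₀ (by exact_mod_cast hl), zero_mul] at this
  exact this

theorem flatten_replicate_finRange [NeZero n] (k : ℕ) :
    (List.replicate k (List.finRange n)).flatten =
      (List.range (k * n)).map fun i => Fin.ofNat n i := by
  induction k with
  | zero => simp
  | succ k ih =>
    rw [List.replicate_succ, List.flatten_cons, ih, Nat.succ_mul, add_comm, List.range_add,
      List.map_append, List.map_map]
    congr 1
    · refine List.ext_getElem (by simp) fun i h1 h2 => ?_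
      simp at h1
      simp [Fin.ext_iff, Nat.mod_eq_of_lt h1]
    · exact List.map_congr_left fun i _ => by simp [Fin.ext_iff]

theorem wInteresting_eq [NeZero n] {g : ℕ} (hg : g ≤ n) :
    wInteresting n g =
      (List.range (g * n + n - g)).map fun i => Fin.ofNat n (i + g) := by
  have h1 : wInteresting n g = ((List.replicate (g + 1) (List.finRange n)).flatten).drop g := by
    rw [List.replicate_succ, List.flatten_cons, List.drop_append_of_le_length (by simpa using hg)]
    rfl
  rw [h1, flatten_replicate_finRange]
  refine List.ext_getElem (by simp [Nat.succ_mul]) fun i _ _ => ?_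
  simp [add_comm]

end Lists
end MaxPlus

namespace MaxPlus

variable {n g : ℕ} {A : Mat n}

theorem exists_cycle_potential (hg : 2 ≤ g) (hlam : lam A = 0) {Z0 : List (Fin n)}
    (hZ0 : IsCritCycle A Z0) (hlen : len Z0 = g) :
    ∃ (y : ZMod g → Fin n) (φ : Fin n → ℝ), Function.Injective y ∧
      (∀ c, arc A (y c) (y (c + 1))) ∧
      (∀ c, realW A (y c) (y (c + 1)) + φ (y c) - φ (y (c + 1)) = 0) ∧
      ∀ v, v ∈ Z0 ↔ v ∈ Set.range y := by
  have : NeZero g := ⟨by omega⟩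
  obtain ⟨hcyc, hmean⟩ := hZ0
  have hne : Z0 ≠ [] := by rintro rfl; simp [len] at hlen; omega
  obtain ⟨x, hx⟩ := exists_map_range Z0 hne
  rw [show Z0.length = g + 1 by unfold len at hlen; omega] at hx
  subst hx
  obtain ⟨-, harc, hclosed, hinj⟩ := isCycle_map_range.1 hcyc
  have hP : partialW (realW A) x g = 0 := by
    rw [mean_map_range harc, hlam, ← WithBot.coe_zero, WithBot.coe_inj] at hmean
    simpa [show g ≠ 0 by omega] using hmean
  let y : ZMod g → Fin n := fun c => x c.val
  have hy : ∀ k ≤ g, y k = x k := by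
    intro k hk
    rcases hk.lt_or_eq with hk | rfl
    · simp only [y, ZMod.val_natCast_of_lt hk]
    · simp only [y, ZMod.natCast_self, ZMod.val_zero, hclosed]
  have hyinj : Function.Injective y := fun c d h =>
    ZMod.val_injective g (hinj (ZMod.val_lt c) (ZMod.val_lt d) h)
  let φ : Fin n → ℝ := fun v => partialW (realW A) x (Function.invFun y v).val
  have hφ : ∀ k ≤ g, φ (y k) = partialW (realW A) x k := by
    intro k hk
    simp only [φ, Function.leftInverse_invFun hyinj _]
    rcases hk.lt_or_eq with hk | rfl
    · rw [ZMod.val_natCast_of_lt hk]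
    · rw [ZMod.natCast_self, ZMod.val_zero, hP]; simp [partialW]
  have hcast : ∀ c : ZMod g, ∃ k < g, c = (k : ZMod g) ∧ c + 1 = ((k + 1 : ℕ) : ZMod g) :=
    fun c => ⟨c.val, ZMod.val_lt c, by simp, by simp⟩
  refine ⟨y, φ, hyinj, fun c => ?_, fun c => ?_, fun v => ?_⟩
  · obtain ⟨k, hk, h1, h2⟩ := hcast c
    rw [h2, h1, hy k hk.le, hy (k + 1) hk]
    exact harc k hk
  · obtain ⟨k, hk, h1, h2⟩ := hcast c
    rw [h2, h1, hφ k hk.le, hφ (k + 1) hk, hy k hk.le, hy (k + 1) hk, partialW_succ]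
    ring
  · simp only [List.mem_map, List.mem_range, Set.mem_range]
    constructor
    · rintro ⟨k, hk, rfl⟩
      exact ⟨k, hy k (by omega)⟩
    · rintro ⟨c, rfl⟩
      have := ZMod.val_lt c
      exact ⟨c.val, by omega, rfl⟩

/-- An interesting walk is tight for the weights normalized by a potential. -/
theorem Interesting.tightWalk (hg : 2 ≤ g) (hgn : g ≤ n) (hlam : lam A = 0) {Z0 : List (Fin n)}
    {y : ZMod g → Fin n} {φ : Fin n → ℝ} (hinj : Function.Injective y)
    (harc : ∀ c, arc A (y c) (y (c + 1)))
    (hφ : ∀ c, realW A (y c) (y (c + 1)) + φ (y c) - φ (y (c + 1)) = 0)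
    (hZ0 : ∀ v, v ∈ Z0 ↔ v ∈ Set.range y) {i j : Fin n} {x : ℕ → Fin n} {N : ℕ}
    (hW : Interesting A g Z0 i j ((List.range (N + 1)).map x)) :
    TightWalk (arc A) (fun u v => realW A u v + φ u - φ v) y x (N + 1) := by
  obtain ⟨⟨⟨⟨⟨-, hchain⟩, hi, hj⟩, ⟨v, hv, hvZ⟩, hres⟩, hmax, hmin⟩, hlen⟩ := hW
  rw [head?_map_range, Option.some_inj] at hi
  rw [getLast?_map_range, Option.some_inj] at hj
  rw [len_map_range] at hres hlen
  have harcx : ∀ k < N, arc A (x k) (x (k + 1)) := fun k hk =>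
    isChain_map_range.1 hchain k (by omega)
  rw [weight_map_range N x harcx] at hmax hmin
  have hcard : N + 1 + g = g * n + n := by
    have : g * (n - 2) + g * 2 = g * n := by rw [← Nat.mul_add]; congr 1; omega
    unfold DM at hlen
    omega
  refine ⟨hg, hcard, hinj, fun l r a h => ?_, harc, hφ, fun k hk => harcx k (by omega), ?_, ?_⟩
  · simpa using closed_nonpos hlam h.potential
  · obtain ⟨k, hk, rfl⟩ := List.mem_map.1 hv
    exact ⟨k, List.mem_range.1 hk, (hZ0 _).1 hvZ⟩
  · intro l₁ l₂ r₁ r₂ c h₁ h₂ hl hr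
    rw [Nat.add_sub_cancel] at h₂ hl hr ⊢
    obtain ⟨x₂, h0, h1, hE, hP⟩ := h₂.potential.exists_seq
    obtain ⟨v, hv0, hvc, hve, hvE, hvP⟩ := h₁.potential.exists_seq_append h0 hE
    have hmem : (List.range (l₁ + l₂ + 1)).map v ∈ ThroughSet A Z0 i j g (DM g n - 1) := by
      refine ⟨?_, ⟨y c, ?_, (hZ0 _).2 ⟨c, rfl⟩⟩, ?_⟩
      · have := isWalkFrom_map_range hvE
        rwa [hv0, hve, h1, hi, hj] at this
      · exact List.mem_map.2 ⟨l₁, List.mem_range.2 (by omega), hvc⟩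
      · rw [len_map_range, ← hres]
        exact (ZMod.natCast_eq_natCast_iff' _ _ _).1 hl
    have hle := hmax _ hmem
    have hlen' := hmin _ hmem
    rw [weight_map_range _ v hvE, hvP, hP] at hle hlen'
    rw [WithBot.coe_le_coe] at hle
    rw [WithBot.coe_inj, len_map_range, len_map_range] at hlen'
    rw [partialW_potential] at hr
    exact hlen' (by linarith)

theorem eq_add_mod_of_periodic {x : ℕ → Fin n} {N : ℕ} (hgn : g ≤ n) (hn : 0 < n)
    (hN : 2 * n - g ≤ N) (hx : ∀ i, i + n < N → x (i + n) = x i) (i : ℕ) :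
    i < N → x i = x (n - g + (i + g) % n) := by
  induction i using Nat.strong_induction_on with
  | _ i ih =>
    intro hi
    rcases lt_or_ge (i + g) n with h | h
    · rw [Nat.mod_eq_of_lt h, ← hx i (by omega)]
      congr 1; omega
    rcases lt_or_ge i n with h' | h'
    · rw [Nat.mod_eq_sub_mod h]
      rcases lt_or_ge (i + g - n) n with h2 | h2
      · rw [Nat.mod_eq_of_lt h2]; congr 1; omega
      · omega
    · have h1 := ih (i - n) (by omega) (by omega)
      rw [← hx (i - n) (by omega), Nat.sub_add_cancel h'] at h1
      rw [h1, show i + g = i - n + g + n by omega, Nat.add_mod_right]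

end MaxPlus


namespace MaxPlus

/-- Proposition 4.9: structure of the interesting walk. Under the stated hypotheses,
for any interesting walk `W₀` there is a renumbering of the nodes such that `1,…,g`
are the nodes of `Z₀` and `W₀ = (g+1)⋯n(1⋯n)^g`. -/
theorem interesting_walk_structure {n : ℕ} (A : Mat n) (g : ℕ)
    (hgdef : g = maxGirth (critArc A)) (hg : 2 ≤ g) (hlam : lam A = 0)
    (hT : T1 A = DM g n) (hne : ¬(n = 2 ∧ g = 2))
    (Z0 : List (Fin n)) (hZ0 : IsCritCycle A Z0) (hZ0len : len Z0 = g)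
    (hSC : ∀ i j, critNode A i → critNode A j → reach (critArc A) i j)
    (huniq : ∀ Z, IsCritCycle A Z → len Z = g → Z.dropLast ~r Z0.dropLast) :
    ∀ i j W0, Interesting A g Z0 i j W0 →
      ∃ σ : Equiv.Perm (Fin n),
        (∀ v : Fin n, v ∈ Z0 ↔ (σ.symm v).val < g) ∧
        W0 = (wInteresting n g).map σ := by
  intro i j W0 hW
  have hgn : g ≤ n := by
    have := hZ0.1.2.2.2.length_le_card
    rwa [List.length_dropLast, Fintype.card_fin, show Z0.length - 1 = g from hZ0len] at this
  have : NeZero n := ⟨by omega⟩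
  obtain ⟨y, φ, hinj, harc, hφ, hmem⟩ := exists_cycle_potential hg hlam hZ0 hZ0len
  obtain ⟨x, hx⟩ := exists_map_range W0 hW.1.1.1.1.1
  obtain ⟨N, hN⟩ : ∃ N, W0.length = N + 1 :=
    Nat.exists_eq_succ_of_ne_zero (by simpa using hW.1.1.1.1.1)
  rw [hN] at hx
  subst hx
  have H := hW.tightWalk hg hgn hlam hinj harc hφ hmem
  obtain ⟨hper, hinjx, hrange⟩ := H.hamiltonian hne
  let s : Fin n → Fin n := fun v => x (n - g + v)
  have hs : Function.Bijective s := Finite.injective_iff_bijective.1 fun u v h =>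
    Fin.ext (hinjx u u.2 v v.2 h)
  refine ⟨Equiv.ofBijective s hs, fun v => ?_, ?_⟩
  · obtain ⟨u, rfl⟩ := hs.2 v
    rw [Equiv.ofBijective_symm_apply_apply, hmem]
    exact hrange u u.2
  · have hcard := H.card
    have h2 := Nat.mul_le_mul_right n hg
    rw [wInteresting_eq hgn, List.map_map, show g * n + n - g = N + 1 by omega]
    refine List.map_congr_left fun k hk => ?_
    exact eq_add_mod_of_periodic hgn (by omega) (by omega) hper k (List.mem_range.1 hk)

end MaxPlus
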